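/- arXiv:1509.02646 — 2 statements merged into one kernel-verified Lean document; each statement's English description precedes it below -/
import Mathlib

section
/- For all real numbers 0 < m < M and every ε > 0 there exists a constant A = A(ε, m, M) > 0 such that for every integer n ≥ 1 and every real c with m ≤ c ≤ M√n, one has λ_n(c) ≤ A · e^{εn} · ( e·c/(4(n + 1/2)) )^{2n+1}. -/
open MeasureTheory

/-- Complete Legendre elliptic integral of the second kind. -/
noncomputable def ellE (k : ℝ) : ℝ :=
  ∫ t in (0:ℝ)..1, Real.sqrt ((1 - k^2 * t^2) / (1 - t^2))

/-- Complete Legendre elliptic integral of the first kind. -/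
noncomputable def ellK (k : ℝ) : ℝ :=
  ∫ t in (0:ℝ)..1, 1 / Real.sqrt ((1 - t^2) * (1 - k^2 * t^2))

/-- The function `Ψ(k) = k / E(k)`. -/
noncomputable def PsiFn (k : ℝ) : ℝ := k / ellE k

/-- `Φ`, the inverse on `[0,1]` of the strictly increasing bijection `Ψ`. -/
noncomputable def PhiFn (x : ℝ) : ℝ :=
  sSup {y : ℝ | y ∈ Set.Icc (0:ℝ) 1 ∧ PsiFn y ≤ x}

/-- The function `𝒥(x) = (π²/4) ∫_{Φ(2x/π)}^1 dt/(t E(t)²)`. -/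
noncomputable def Jcal (x : ℝ) : ℝ :=
  (Real.pi^2 / 4) * ∫ t in PhiFn (2*x/Real.pi)..(1:ℝ), 1 / (t * (ellE t)^2)

/-- The function `𝒥_l(c) = (π/2) ∫_c^{πl/2} dτ/(Φ(2τ/(πl)) K(Φ(2τ/(πl))))`. -/
noncomputable def Jl (l c : ℝ) : ℝ :=
  (Real.pi / 2) * ∫ τ in c..(Real.pi * l / 2),
    1 / (PhiFn (2*τ/(Real.pi*l)) * ellK (PhiFn (2*τ/(Real.pi*l))))

/-- The approximation `λ̃_n(c)`. -/
noncomputable def lambdaTilde (n : ℕ) (c : ℝ) : ℝ :=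
  (1/2) * Real.exp (-(Real.pi^2 * ((n:ℝ) + 1/2) / 2) *
    ∫ t in PhiFn (2*c/(Real.pi*((n:ℝ)+1/2)))..(1:ℝ), 1 / (t * (ellE t)^2))

/-- The kernel `sin(c(x-y))/(π(x-y))`, with value `c/π` on the diagonal. -/
noncomputable def sincKernel (c x y : ℝ) : ℝ :=
  if x = y then c / Real.pi else Real.sin (c*(x-y)) / (Real.pi * (x-y))

/-- The quadratic form `⟨Q_c f, f⟩` of the time-and-frequency limiting operator `Q_c`. -/
noncomputable def QForm (c : ℝ) (f : ℝ → ℝ) : ℝ :=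
  ∫ x in Set.Ioo (-1:ℝ) 1, ∫ y in Set.Ioo (-1:ℝ) 1, sincKernel c x y * f y * f x

/-- The `(n+1)`-st eigenvalue `λ_n(c)` of `Q_c`, via the Courant–Fischer min-max principle. -/
noncomputable def lambda (n : ℕ) (c : ℝ) : ℝ :=
  ⨆ V : {V : Submodule ℝ (Lp ℝ 2 (volume.restrict (Set.Ioo (-1:ℝ) 1))) //
          Module.finrank ℝ V = n + 1},
    ⨅ f : {f : Lp ℝ 2 (volume.restrict (Set.Ioo (-1:ℝ) 1)) // f ∈ V.1 ∧ f ≠ 0},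
      QForm c (f.1 : ℝ → ℝ) / ‖f.1‖^2

theorem Matrix.det_sum_mul {ι β : Type*} [Fintype ι] [DecidableEq ι] [Fintype β] [DecidableEq β]
    (C Y : ι → β → ℝ) :
    (Matrix.of fun i j => ∑ b, C i b * Y j b).det =
      ∑ g : ι → β, (∏ j, Y j (g j)) * (Matrix.of fun i j => C i (g j)).det := by
  simp only [Matrix.det_apply', Matrix.of_apply, Finset.mul_sum]
  rw [Finset.sum_comm]
  refine Finset.sum_congr rfl fun σ _ => ?_
  rw [Finset.prod_univ_sum, Fintype.piFinset_univ, Finset.mul_sum]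
  refine Finset.sum_congr rfl fun g _ => ?_
  rw [Finset.prod_mul_distrib]
  ring

theorem exists_pow_eq_sum_chebyshev (l : ℕ) :
    ∃ b : ℕ → ℝ, (∀ a, 0 ≤ b a) ∧ (∀ a, l < a → b a = 0) ∧
      ∀ x : ℝ, x ^ l = ∑ a ∈ Finset.range (l + 1), b a * (Polynomial.Chebyshev.T ℝ a).eval x := by
  induction l with
  | zero => exact ⟨fun a => if a = 0 then 1 else 0, fun a => by positivity,
      fun a ha => by simp [ha.ne'], fun x => by simp⟩
  | succ l ih =>
    obtain ⟨b, hb, hb0, hx⟩ := ih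
    refine ⟨fun a => (if a = 0 then 0 else b (a - 1) / 2) + b (a + 1) / 2 +
      (if a = 1 then b 0 / 2 else 0), fun a => ?_, fun a ha => ?_, fun x => ?_⟩
    · have h1 := hb (a - 1)
      have h2 := hb (a + 1)
      have h3 := hb 0
      dsimp only
      split_ifs <;> positivity
    · have h1 := hb0 (a - 1) (by omega)
      have h2 := hb0 (a + 1) (by omega)
      have : a ≠ 0 := by omega
      by_cases h : a = 1
      · omega
      · simp [h1, h2, this, h]
    · have key : ∀ a : ℕ, x * (Polynomial.Chebyshev.T ℝ (a + 1 : ℕ)).eval x =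
          ((Polynomial.Chebyshev.T ℝ (a + 2 : ℕ)).eval x +
            (Polynomial.Chebyshev.T ℝ a).eval x) / 2 := by
        intro a
        have := Polynomial.Chebyshev.T_add_two ℝ (a : ℤ)
        push_cast
        rw [this]
        simp
        ring
      set t : ℕ → ℝ := fun a => (Polynomial.Chebyshev.T ℝ a).eval x with ht
      have ht0 : t 0 = 1 := by simp [ht]
      have ht1 : t 1 = x := by simp [ht]
      have key' : ∀ a, x * t (a + 1) = (t (a + 2) + t a) / 2 := key
      have hxs : x ^ l = ∑ a ∈ Finset.range (l + 1), b a * t a := hx x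
      change x ^ (l + 1) = ∑ a ∈ Finset.range (l + 1 + 1), _ * t a
      have e1 : x ^ (l + 1) = b 0 * x + ∑ a ∈ Finset.range l, b (a + 1) * ((t (a + 2) + t a) / 2) := by
        rw [pow_succ', hxs, Finset.sum_range_succ', mul_add, Finset.mul_sum, ht0, add_comm]
        congr 1
        · ring
        · exact Finset.sum_congr rfl fun a _ => by rw [← key']; ring
      simp only [add_mul, Finset.sum_add_distrib]
      have e2 : ∑ a ∈ Finset.range (l + 1 + 1), (if a = 0 then 0 else b (a - 1) / 2) * t a
          = b 0 / 2 * x + ∑ a ∈ Finset.range l, b (a + 1) / 2 * t (a + 2) := by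
        rw [Finset.sum_range_succ', Finset.sum_range_succ']
        simp [ht1]
        ring
      have e3 : ∑ a ∈ Finset.range (l + 1 + 1), b (a + 1) / 2 * t a =
          ∑ a ∈ Finset.range l, b (a + 1) / 2 * t a := by
        rw [Finset.sum_range_succ, Finset.sum_range_succ, hb0 (l + 1) (by omega),
          hb0 (l + 1 + 1) (by omega)]
        simp
      have e4 : ∑ a ∈ Finset.range (l + 1 + 1), (if a = 1 then b 0 / 2 else 0) * t a =
          b 0 / 2 * x := by
        rw [Finset.sum_eq_single 1]
        · simp [ht1]
        · intro a _ ha; simp [ha]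
        · intro h; simp at h
      rw [e1, e2, e3, e4]
      have : ∑ a ∈ Finset.range l, b (a + 1) * ((t (a + 2) + t a) / 2) =
          ∑ a ∈ Finset.range l, b (a + 1) / 2 * t (a + 2) +
          ∑ a ∈ Finset.range l, b (a + 1) / 2 * t a := by
        rw [← Finset.sum_add_distrib]
        exact Finset.sum_congr rfl fun a _ => by ring
      rw [this]
      ring

theorem exists_perm_le_of_injective {m N : ℕ} {g : Fin m → Fin N} (hg : Function.Injective g) :
    ∃ σ : Equiv.Perm (Fin m), ∀ k : Fin m, (k : ℕ) ≤ g (σ k) := by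
  refine ⟨Tuple.sort g, fun k => ?_⟩
  have hs : StrictMono (g ∘ Tuple.sort g) :=
    (Tuple.monotone_sort g).strictMono_of_injective (hg.comp (Tuple.sort g).injective)
  obtain ⟨k, hk⟩ := k
  induction k with
  | zero => simp
  | succ k ih =>
    have h1 := ih (by omega)
    have h2 : g (Tuple.sort g ⟨k, by omega⟩) < g (Tuple.sort g ⟨k + 1, hk⟩) :=
      hs (show (⟨k, by omega⟩ : Fin m) < ⟨k + 1, hk⟩ by simp [Fin.lt_def])
    have h3 := Fin.lt_def.1 h2
    simp only at h1 ⊢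
    omega

theorem sum_le_sum_of_injective {m N : ℕ} {g : Fin m → Fin N} (hg : Function.Injective g) :
    ∑ k : Fin m, (k : ℕ) ≤ ∑ k, (g k : ℕ) := by
  obtain ⟨σ, hσ⟩ := exists_perm_le_of_injective hg
  rw [← Equiv.sum_comp σ (fun k => (g k : ℕ))]
  exact Finset.sum_le_sum fun k _ => hσ k

theorem abs_det_pow_le {m : ℕ} {x : Fin m → ℝ} (hx : ∀ i, |x i| ≤ 1) (l : Fin m → ℕ)
    {θ : ℝ} (hθ : 0 ≤ θ) :
    |(Matrix.of fun i j => x i ^ l j).det| ≤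
      m.factorial * 2 ^ m * Real.exp (-(θ * ∑ k : Fin m, (k : ℕ))) * ∏ j, Real.cosh θ ^ l j := by
  classical
  choose b hb hb0 hbx using exists_pow_eq_sum_chebyshev
  obtain ⟨N, hN⟩ : ∃ N : ℕ, ∀ j, l j < N :=
    ⟨∑ j, l j + 1, fun j => Nat.lt_succ_of_le (Finset.single_le_sum (fun _ _ => Nat.zero_le _)
      (Finset.mem_univ j))⟩
  set T : ℕ → ℝ → ℝ := fun a y => (Polynomial.Chebyshev.T ℝ a).eval y with hT
  have hsum : ∀ j y, y ^ l j = ∑ a : Fin N, T a y * b (l j) a := by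
    intro j y
    rw [hbx, Fin.sum_univ_eq_sum_range (fun a => T a y * b (l j) a)]
    rw [← Finset.sum_subset (Finset.range_subset_range.2 (hN j))]
    · exact Finset.sum_congr rfl fun a _ => mul_comm _ _
    · intro a _ ha
      rw [hb0 _ _ (by simpa using ha), mul_zero]
  have hdet : (Matrix.of fun i j => x i ^ l j).det = ∑ g : Fin m → Fin N,
      (∏ j, b (l j) (g j)) * (Matrix.of fun i j => T (g j) (x i)).det := by
    rw [← Matrix.det_sum_mul (fun i (a : Fin N) => T a (x i)) (fun j a => b (l j) a)]
    simp only [hsum]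
  have hTc : ∀ a : ℕ, Real.exp (θ * a) / 2 ≤ T a (Real.cosh θ) := by
    intro a
    simp only [hT]
    rw [Polynomial.Chebyshev.T_real_cosh, Real.cosh_eq]
    have := Real.exp_pos (-(((a : ℤ) : ℝ) * θ))
    rw [mul_comm θ]
    push_cast at *
    linarith
  have hterm : ∀ g : Fin m → Fin N,
      |(∏ j, b (l j) (g j)) * (Matrix.of fun i j => T (g j) (x i)).det| ≤
      m.factorial * 2 ^ m * Real.exp (-(θ * ∑ k : Fin m, (k : ℕ))) *
        ∏ j, (T (g j) (Real.cosh θ) * b (l j) (g j)) := by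
    intro g
    have hTpos : ∀ a, 0 < T a (Real.cosh θ) := fun a => lt_of_lt_of_le (by positivity) (hTc a)
    have hR : 0 ≤ ∏ j, (T (g j) (Real.cosh θ) * b (l j) (g j)) :=
      Finset.prod_nonneg fun j _ => mul_nonneg (hTpos _).le (hb _ _)
    by_cases hg : Function.Injective g
    · have h1 : |(Matrix.of fun i j => T (g j) (x i)).det| ≤ m.factorial := by
        have := Matrix.det_le (A := Matrix.of fun i j => T (g j) (x i)) (abv := AbsoluteValue.abs)
          (x := 1) (fun i j => by
            simpa [hT] using Polynomial.Chebyshev.abs_eval_T_real_le_one _ (hx i))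
        simpa using this
      have h2 : (∏ j, b (l j) (g j)) ≤ 2 ^ m * Real.exp (-(θ * ∑ k : Fin m, (k : ℕ))) *
          ∏ j, (T (g j) (Real.cosh θ) * b (l j) (g j)) := by
        have h3 : ∏ j, b (l j) (g j) ≤
            ∏ j, (2 * Real.exp (-(θ * (g j : ℕ))) * (T (g j) (Real.cosh θ) * b (l j) (g j))) := by
          refine Finset.prod_le_prod (fun j _ => hb _ _) fun j _ => ?_
          have h4 := hTc (g j)
          have h5 : 1 ≤ 2 * Real.exp (-(θ * (g j : ℕ))) * T (g j) (Real.cosh θ) := by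
            rw [Real.exp_neg]
            have := Real.exp_pos (θ * (g j : ℕ))
            field_simp
            linarith
          nlinarith [hb (l j) (g j)]
        rw [Finset.prod_mul_distrib, Finset.prod_mul_distrib, ← Real.exp_sum] at h3
        refine h3.trans ?_
        gcongr
        · simp
        · rw [Finset.sum_neg_distrib, ← Finset.mul_sum]
          have := sum_le_sum_of_injective hg
          have h6 : ((∑ k : Fin m, (k : ℕ) : ℕ) : ℝ) ≤ ((∑ k, (g k : ℕ) : ℕ) : ℝ) := by
            exact_mod_cast this
          push_cast at h6
          push_cast
          nlinarith
      rw [abs_mul, abs_of_nonneg (Finset.prod_nonneg fun j _ => hb _ _)]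
      calc _ ≤ (2 ^ m * Real.exp (-(θ * ∑ k : Fin m, (k : ℕ))) *
          ∏ j, (T (g j) (Real.cosh θ) * b (l j) (g j))) * m.factorial := by gcongr
        _ = _ := by ring
    · obtain ⟨i, j, hij, hne⟩ : ∃ i j, g i = g j ∧ i ≠ j := by
        simpa [Function.Injective] using hg
      rw [Matrix.det_zero_of_column_eq hne (fun k => by simp [hij])]
      simp only [mul_zero, abs_zero]
      positivity
  rw [hdet]
  refine (Finset.abs_sum_le_sum_abs _ _).trans ((Finset.sum_le_sum fun g _ => hterm g).trans ?_)
  rw [← Finset.mul_sum]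
  refine le_of_eq ?_
  congr 1
  simp only [hsum _ (Real.cosh θ)]
  rw [Finset.prod_univ_sum, Fintype.piFinset_univ]

theorem factorial_mul_det_sum_mul {m N : ℕ} (d : Fin N → ℝ) (x ξ : Fin m → ℝ) :
    m.factorial * (Matrix.of fun i j => ∑ l : Fin N, d l * x i ^ (l : ℕ) * ξ j ^ (l : ℕ)).det =
      ∑ l : Fin m → Fin N, (∏ j, d (l j)) * (Matrix.of fun i j => x i ^ (l j : ℕ)).det *
        (Matrix.of fun i j => ξ i ^ (l j : ℕ)).det := by
  classical
  have h := Matrix.det_sum_mul (fun i (l : Fin N) => x i ^ (l : ℕ))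
    (fun j l => d l * ξ j ^ (l : ℕ))
  have e : (Matrix.of fun i j => ∑ l : Fin N, d l * x i ^ (l : ℕ) * ξ j ^ (l : ℕ)).det =
      ∑ l : Fin m → Fin N, (∏ j, (d (l j) * ξ j ^ (l j : ℕ))) *
        (Matrix.of fun i j => x i ^ (l j : ℕ)).det := by
    rw [← h]
    congr 1
    ext i j
    simp only [Matrix.of_apply]
    exact Finset.sum_congr rfl fun l _ => by ring
  have hs : ∀ σ : Equiv.Perm (Fin m),
      (Matrix.of fun i j => ∑ l : Fin N, d l * x i ^ (l : ℕ) * ξ j ^ (l : ℕ)).det =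
      ∑ l : Fin m → Fin N, (∏ j, d (l j)) * (Matrix.of fun i j => x i ^ (l j : ℕ)).det *
        (((Equiv.Perm.sign σ : ℤ) : ℝ) * ∏ j, ξ j ^ (l (σ j) : ℕ)) := by
    intro σ
    rw [e, ← Equiv.sum_comp (Equiv.arrowCongr σ.symm (Equiv.refl (Fin N)))]
    refine Finset.sum_congr rfl fun l _ => ?_
    have h1 : (Matrix.of fun i j => x i ^ (l (σ j) : ℕ)).det =
        ((Equiv.Perm.sign σ : ℤ) : ℝ) * (Matrix.of fun i j => x i ^ (l j : ℕ)).det := by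
      rw [← Matrix.det_permute']
      rfl
    simp only [Equiv.arrowCongr_apply, Equiv.symm_symm, Equiv.coe_refl, Function.comp, id]
    rw [h1, Finset.prod_mul_distrib, Equiv.prod_comp σ (fun j => d (l j))]
    ring
  have h2 : (m.factorial : ℝ) * (Matrix.of fun i j => ∑ l : Fin N, d l * x i ^ (l : ℕ) *
      ξ j ^ (l : ℕ)).det = ∑ σ : Equiv.Perm (Fin m), (Matrix.of fun i j => ∑ l : Fin N,
        d l * x i ^ (l : ℕ) * ξ j ^ (l : ℕ)).det := by
    simp [Fintype.card_perm]
  rw [h2, Finset.sum_congr rfl fun σ _ => hs σ, Finset.sum_comm]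
  refine Finset.sum_congr rfl fun l _ => ?_
  rw [← Finset.mul_sum]
  congr 1
  rw [← Matrix.det_transpose, Matrix.det_apply']
  simp

theorem sum_injective_le {m N : ℕ} {y : ℝ} (hy : 0 ≤ y) :
    ∑ l : Fin m → Fin N with Function.Injective l, ∏ j, (y ^ (l j : ℕ) / (l j : ℕ).factorial) ≤
      m.factorial * ∏ k : Fin m, (y ^ (k : ℕ) / (k : ℕ).factorial * Real.exp y) := by
  classical
  have h1 : ∀ l : Fin m → Fin N, Function.Injective l →
      ∏ j, (y ^ (l j : ℕ) / (l j : ℕ).factorial) ≤ ∑ σ : Equiv.Perm (Fin m),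
        ∏ k : Fin m, (if (k : ℕ) ≤ l (σ k) then y ^ (l (σ k) : ℕ) / (l (σ k) : ℕ).factorial else 0) := by
    intro l hl
    obtain ⟨σ, hσ⟩ := exists_perm_le_of_injective hl
    refine le_trans (le_of_eq ?_) (Finset.single_le_sum (f := fun σ : Equiv.Perm (Fin m) =>
      ∏ k : Fin m, (if (k : ℕ) ≤ l (σ k) then y ^ (l (σ k) : ℕ) / (l (σ k) : ℕ).factorial else 0))
      (fun σ _ => Finset.prod_nonneg fun k _ => by split_ifs <;> positivity) (Finset.mem_univ σ))
    rw [← Equiv.prod_comp σ]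
    exact Finset.prod_congr rfl fun k _ => by rw [if_pos (hσ k)]
  have h2 : ∀ k : ℕ, ∑ a : Fin N, (if k ≤ (a : ℕ) then y ^ (a : ℕ) / (a : ℕ).factorial else 0) ≤
      y ^ k / k.factorial * Real.exp y := by
    intro k
    rw [Fin.sum_univ_eq_sum_range (fun a => if k ≤ a then y ^ a / a.factorial else 0),
      ← Finset.sum_filter]
    have h3 : ∀ a ∈ (Finset.range N).filter (fun a => k ≤ a), y ^ a / a.factorial ≤
        y ^ k / k.factorial * (y ^ (a - k) / (a - k).factorial) := by
      intro a ha
      have hk := (Finset.mem_filter.1 ha).2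
      rw [div_mul_div_comm, ← pow_add, Nat.add_sub_cancel' hk]
      gcongr
      exact_mod_cast Nat.le_of_dvd (Nat.factorial_pos _) (Nat.factorial_mul_factorial_dvd_factorial hk)
    refine (Finset.sum_le_sum h3).trans ?_
    rw [← Finset.mul_sum]
    gcongr
    calc _ ≤ ∑ a ∈ Finset.range N, y ^ a / a.factorial := by
          rw [← Finset.sum_image (s := (Finset.range N).filter (fun a => k ≤ a)) (g := fun a => a - k)
            (f := fun a => y ^ a / a.factorial)]
          · refine Finset.sum_le_sum_of_subset_of_nonneg ?_ fun _ _ _ => by positivity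
            intro a ha
            simp only [Finset.mem_image, Finset.mem_filter, Finset.mem_range] at ha ⊢
            omega
          · intro a ha b hb hab
            simp only [Finset.coe_filter, Finset.mem_range, Set.mem_ofPred_eq] at ha hb
            simp only at hab
            omega
      _ ≤ _ := Real.sum_le_exp_of_nonneg hy N
  calc _ ≤ ∑ l : Fin m → Fin N with Function.Injective l, ∑ σ : Equiv.Perm (Fin m),
        ∏ k : Fin m, (if (k : ℕ) ≤ l (σ k) then y ^ (l (σ k) : ℕ) / (l (σ k) : ℕ).factorial else 0) :=
        Finset.sum_le_sum fun l hl => h1 l (Finset.mem_filter.1 hl).2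
    _ ≤ ∑ l : Fin m → Fin N, ∑ σ : Equiv.Perm (Fin m),
        ∏ k : Fin m, (if (k : ℕ) ≤ l (σ k) then y ^ (l (σ k) : ℕ) / (l (σ k) : ℕ).factorial else 0) :=
        Finset.sum_le_sum_of_subset_of_nonneg (Finset.filter_subset _ _) fun l _ _ =>
          Finset.sum_nonneg fun σ _ => Finset.prod_nonneg fun k _ => by split_ifs <;> positivity
    _ = ∑ σ : Equiv.Perm (Fin m), ∑ l : Fin m → Fin N,
        ∏ k : Fin m, (if (k : ℕ) ≤ l k then y ^ (l k : ℕ) / (l k : ℕ).factorial else 0) := by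
        rw [Finset.sum_comm]
        refine Finset.sum_congr rfl fun σ _ => ?_
        rw [← Equiv.sum_comp (Equiv.arrowCongr σ.symm (Equiv.refl (Fin N)))
          (fun l : Fin m → Fin N => ∏ k : Fin m,
            (if (k : ℕ) ≤ l k then y ^ (l k : ℕ) / (l k : ℕ).factorial else 0))]
        rfl
    _ = m.factorial * ∏ k : Fin m, ∑ a : Fin N,
        (if (k : ℕ) ≤ a then y ^ (a : ℕ) / (a : ℕ).factorial else 0) := by
        rw [Finset.prod_univ_sum, Fintype.piFinset_univ]
        simp [Fintype.card_perm]
    _ ≤ _ := by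
        gcongr with k
        exact h2 k

/-- The Hartley kernel `cos t + sin t`. -/
noncomputable def cas (t : ℝ) : ℝ := Real.cos t + Real.sin t

theorem hasSum_cas (t : ℝ) : HasSum (fun l : ℕ => (-1) ^ (l / 2) * (t ^ l / l.factorial)) (cas t) := by
  refine HasSum.even_add_odd ?_ ?_
  · convert Real.hasSum_cos t using 2 with k
    simp
    ring
  · convert Real.hasSum_sin t using 2 with k
    rw [show (2 * k + 1) / 2 = k by omega]
    ring

/-- The determinant of the matrix `cas (c * x i * ξ j)`. -/
noncomputable def casDet (c : ℝ) {k : ℕ} (x ξ : Fin k → ℝ) : ℝ :=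
  (Matrix.of fun i j => cas (c * x i * ξ j)).det

theorem abs_det_sum_le {m N : ℕ} {c θ : ℝ} (hc : 0 ≤ c) (hθ : 0 ≤ θ) {x ξ : Fin m → ℝ}
    (hx : ∀ i, |x i| ≤ 1) (hξ : ∀ i, |ξ i| ≤ 1) {d : Fin N → ℝ}
    (hd : ∀ l : Fin N, |d l| ≤ c ^ (l : ℕ) / (l : ℕ).factorial) :
    |(Matrix.of fun i j => ∑ l : Fin N, d l * x i ^ (l : ℕ) * ξ j ^ (l : ℕ)).det| ≤
      (m.factorial * 2 ^ m * Real.exp (-(θ * ∑ k : Fin m, (k : ℕ)))) ^ 2 *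
        ∏ k : Fin m, ((c * Real.cosh θ ^ 2) ^ (k : ℕ) / (k : ℕ).factorial *
          Real.exp (c * Real.cosh θ ^ 2)) := by
  classical
  set K := m.factorial * 2 ^ m * Real.exp (-(θ * ∑ k : Fin m, (k : ℕ))) with hK
  set y := c * Real.cosh θ ^ 2 with hy
  have hK0 : 0 ≤ K := by positivity
  have hm : (0 : ℝ) < m.factorial := by positivity
  refine le_of_mul_le_mul_left ?_ hm
  rw [← abs_of_pos hm, ← abs_mul, factorial_mul_det_sum_mul, abs_of_pos hm]
  have hterm : ∀ l : Fin m → Fin N, |(∏ j, d (l j)) * (Matrix.of fun i j => x i ^ (l j : ℕ)).det *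
        (Matrix.of fun i j => ξ i ^ (l j : ℕ)).det| ≤
      if Function.Injective l then K ^ 2 * ∏ j, (y ^ (l j : ℕ) / (l j : ℕ).factorial) else 0 := by
    intro l
    split_ifs with hl
    · rw [abs_mul, abs_mul, Finset.abs_prod]
      calc _ ≤ (∏ j, (c ^ (l j : ℕ) / (l j : ℕ).factorial)) *
            (K * ∏ j, Real.cosh θ ^ (l j : ℕ)) * (K * ∏ j, Real.cosh θ ^ (l j : ℕ)) := by
            gcongr
            · exact hd _
            · exact abs_det_pow_le hx _ hθ
            · exact abs_det_pow_le hξ _ hθ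
        _ = K ^ 2 * ∏ j, ((c ^ (l j : ℕ) / (l j : ℕ).factorial) *
              (Real.cosh θ ^ (l j : ℕ)) * (Real.cosh θ ^ (l j : ℕ))) := by
            rw [Finset.prod_mul_distrib, Finset.prod_mul_distrib]
            ring
        _ = _ := by
            congr 1
            refine Finset.prod_congr rfl fun j _ => ?_
            rw [hy, mul_pow, ← pow_mul, mul_comm 2, pow_mul]
            ring
    · obtain ⟨i, j, hij, hne⟩ : ∃ i j, l i = l j ∧ i ≠ j := by
        simpa [Function.Injective] using hl
      rw [Matrix.det_zero_of_column_eq hne (fun k => by simp [hij])]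
      simp
  refine (Finset.abs_sum_le_sum_abs _ _).trans ((Finset.sum_le_sum fun l _ => hterm l).trans ?_)
  rw [← Finset.sum_filter, ← Finset.mul_sum]
  have := sum_injective_le (m := m) (N := N) (y := y) (by positivity)
  calc _ ≤ K ^ 2 * _ := mul_le_mul_of_nonneg_left this (by positivity)
    _ = _ := by ring

theorem abs_casDet_le {m : ℕ} {c θ : ℝ} (hc : 0 ≤ c) (hθ : 0 ≤ θ) {x ξ : Fin m → ℝ}
    (hx : ∀ i, |x i| ≤ 1) (hξ : ∀ i, |ξ i| ≤ 1) :
    |casDet c x ξ| ≤ (m.factorial * 2 ^ m * Real.exp (-(θ * ∑ k : Fin m, (k : ℕ)))) ^ 2 *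
        ∏ k : Fin m, ((c * Real.cosh θ ^ 2) ^ (k : ℕ) / (k : ℕ).factorial *
          Real.exp (c * Real.cosh θ ^ 2)) := by
  have hlim : Filter.Tendsto (fun N : ℕ => Matrix.of fun i j : Fin m =>
      ∑ l : Fin N, (-1) ^ ((l : ℕ) / 2) * (c ^ (l : ℕ) / (l : ℕ).factorial) * x i ^ (l : ℕ) *
        ξ j ^ (l : ℕ)) Filter.atTop
      (nhds (Matrix.of fun i j => cas (c * x i * ξ j))) := by
    refine tendsto_pi_nhds.2 fun i => tendsto_pi_nhds.2 fun j => ?_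
    refine (hasSum_cas (c * x i * ξ j)).tendsto_sum_nat.congr fun N => ?_
    simp only [Matrix.of_apply]
    rw [← Fin.sum_univ_eq_sum_range]
    refine Finset.sum_congr rfl fun l _ => ?_
    rw [mul_pow, mul_pow]
    ring
  have hcont : Continuous fun A : Matrix (Fin m) (Fin m) ℝ => |A.det| :=
    (continuous_id.matrix_det).abs
  refine le_of_tendsto ((hcont.tendsto _).comp hlim) (Filter.Eventually.of_forall fun N => ?_)
  refine abs_det_sum_le hc hθ hx hξ fun l => ?_
  rw [abs_mul, abs_pow, abs_neg, abs_one, one_pow, one_mul, abs_of_nonneg (by positivity)]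

@[fun_prop]
theorem continuous_cas : Continuous cas := by
  unfold cas
  fun_prop

theorem abs_cas_le (t : ℝ) : |cas t| ≤ 2 := by
  unfold cas
  exact (abs_add_le _ _).trans (by linarith [Real.abs_cos_le_one t, Real.abs_sin_le_one t])

theorem sincKernel_eq_integral {c : ℝ} (hc : 0 < c) (x y : ℝ) :
    sincKernel c x y = c / (2 * Real.pi) * ∫ ξ in Set.Ioo (-1 : ℝ) 1, cas (c * x * ξ) * cas (c * y * ξ) := by
  rw [← integral_Ioc_eq_integral_Ioo, ← intervalIntegral.integral_of_le (by norm_num)]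
  have h1 : ∀ ξ : ℝ, cas (c * x * ξ) * cas (c * y * ξ) =
      Real.cos (c * (x - y) * ξ) + Real.sin (c * (x + y) * ξ) := by
    intro ξ
    rw [show c * (x - y) * ξ = c * x * ξ - c * y * ξ by ring,
      show c * (x + y) * ξ = c * x * ξ + c * y * ξ by ring, Real.cos_sub, Real.sin_add]
    unfold cas
    ring
  simp only [h1]
  rw [intervalIntegral.integral_add (Continuous.intervalIntegrable (by fun_prop) _ _)
    (Continuous.intervalIntegrable (by fun_prop) _ _)]
  have h2 : ∫ ξ in (-1 : ℝ)..1, Real.sin (c * (x + y) * ξ) = 0 := by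
    rcases eq_or_ne (c * (x + y)) 0 with h | h
    · simp [h]
    · rw [intervalIntegral.integral_comp_mul_left (fun t => Real.sin t) h, integral_sin]
      simp
  rw [h2, add_zero, sincKernel]
  split_ifs with h
  · subst h
    simp
    field_simp
    norm_num
  · have h3 : c * (x - y) ≠ 0 := mul_ne_zero hc.ne' (sub_ne_zero.2 h)
    have h4 : x - y ≠ 0 := sub_ne_zero.2 h
    rw [intervalIntegral.integral_comp_mul_left (fun t => Real.cos t) h3, integral_cos]
    simp
    field_simp
    ring

/-- The Hartley transform of `f` on `(-1, 1)`. -/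
noncomputable def hartley (c : ℝ) (f : ℝ → ℝ) (ξ : ℝ) : ℝ :=
  ∫ x in Set.Ioo (-1 : ℝ) 1, cas (c * x * ξ) * f x

theorem integrable_cas_mul {c : ℝ} {f : ℝ → ℝ} (hf : IntegrableOn f (Set.Ioo (-1 : ℝ) 1)) (ξ : ℝ) :
    IntegrableOn (fun x => cas (c * x * ξ) * f x) (Set.Ioo (-1 : ℝ) 1) :=
  Integrable.bdd_mul (c := 2) hf (by fun_prop : Continuous fun x => cas (c * x * ξ)).aestronglyMeasurable
    (Filter.Eventually.of_forall fun x => abs_cas_le _)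

theorem QForm_eq {c : ℝ} (hc : 0 < c) {f : ℝ → ℝ} (hf : IntegrableOn f (Set.Ioo (-1 : ℝ) 1)) :
    QForm c f = c / (2 * Real.pi) * ∫ ξ in Set.Ioo (-1 : ℝ) 1, hartley c f ξ ^ 2 := by
  set μ := volume.restrict (Set.Ioo (-1 : ℝ) 1) with hμ
  have h1 : Integrable (fun p : ℝ × ℝ => cas (c * p.2 * p.1) * f p.2) (μ.prod μ) :=
    Integrable.bdd_mul (c := 2) (hf.comp_snd μ)
      (by fun_prop : Continuous fun p : ℝ × ℝ => cas (c * p.2 * p.1)).aestronglyMeasurable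
      (Filter.Eventually.of_forall fun x => abs_cas_le _)
  have h2 : ∀ x, Integrable (fun p : ℝ × ℝ => cas (c * x * p.1) * (cas (c * p.2 * p.1) * f p.2))
      (μ.prod μ) := fun x =>
    Integrable.bdd_mul (c := 2) h1
      (by fun_prop : Continuous fun p : ℝ × ℝ => cas (c * x * p.1)).aestronglyMeasurable
      (Filter.Eventually.of_forall fun x => abs_cas_le _)
  have h3 : ∀ x, ∫ y, sincKernel c x y * f y * f x ∂μ =
      c / (2 * Real.pi) * ∫ ξ, (cas (c * x * ξ) * f x) * hartley c f ξ ∂μ := by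
    intro x
    have e1 : ∀ y, sincKernel c x y * f y * f x = (c / (2 * Real.pi) * f x) *
        ∫ ξ, cas (c * x * ξ) * (cas (c * y * ξ) * f y) ∂μ := by
      intro y
      rw [sincKernel_eq_integral hc]
      simp only [← mul_assoc]
      rw [integral_mul_const]
      ring
    simp only [e1]
    rw [integral_const_mul, ← integral_integral_swap (f := fun ξ y =>
      cas (c * x * ξ) * (cas (c * y * ξ) * f y)) (h2 x), mul_assoc, ← integral_const_mul]
    congr 1
    refine integral_congr_ae (Filter.Eventually.of_forall fun ξ => ?_)
    simp only [hartley]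
    rw [integral_const_mul]
    ring
  have h4 : AEStronglyMeasurable (hartley c f) μ := h1.aestronglyMeasurable.integral_prod_right'
  have h5 : ∀ ξ, ‖hartley c f ξ‖ ≤ ∫ x, 2 * |f x| ∂μ := by
    intro ξ
    refine norm_integral_le_of_norm_le (hf.abs.const_mul 2) (Filter.Eventually.of_forall fun x => ?_)
    rw [norm_mul]
    exact mul_le_mul_of_nonneg_right (abs_cas_le _) (abs_nonneg _)
  have h6 : Integrable (fun p : ℝ × ℝ => (cas (c * p.1 * p.2) * f p.1) * hartley c f p.2) (μ.prod μ) := by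
    have := Integrable.bdd_mul (c := ∫ x, 2 * |f x| ∂μ) h1.swap h4.comp_snd
      (Filter.Eventually.of_forall fun x => h5 _)
    refine this.congr (Filter.Eventually.of_forall fun p => ?_)
    simp [mul_comm]
  unfold QForm
  rw [← hμ]
  simp only [h3]
  rw [integral_const_mul, integral_integral_swap (f := fun x ξ =>
      (cas (c * x * ξ) * f x) * hartley c f ξ) h6]
  congr 1
  refine integral_congr_ae (Filter.Eventually.of_forall fun ξ => ?_)
  simp only
  rw [integral_mul_const, sq]
  rfl

theorem casDet_cons_row (c : ℝ) {k : ℕ} (x ξ : Fin k → ℝ) (b : ℝ) :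
    ∃ α : Fin k → ℝ, ∀ a, casDet c (Fin.cons a x) (Fin.cons b ξ) =
      casDet c x ξ * cas (c * a * b) + ∑ j, α j * cas (c * a * ξ j) := by
  refine ⟨fun j => (-1) ^ ((j : ℕ) + 1) * (Matrix.of fun (i i' : Fin k) =>
    cas (c * x i * (Fin.cons b ξ : Fin (k + 1) → ℝ) (j.succ.succAbove i'))).det, fun a => ?_⟩
  unfold casDet
  rw [Matrix.det_succ_row_zero, Fin.sum_univ_succ]
  congr 1
  · simp [Matrix.submatrix, mul_comm]
  · refine Finset.sum_congr rfl fun j _ => ?_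
    simp [Matrix.submatrix]
    ring

theorem casDet_comm (c : ℝ) {k : ℕ} (x ξ : Fin k → ℝ) : casDet c x ξ = casDet c ξ x := by
  unfold casDet
  rw [← Matrix.det_transpose]
  congr 1
  ext i j
  simp [mul_right_comm]

theorem exists_mem_hartley_eq_zero {n k : ℕ} (hk : k ≤ n) (c : ℝ) (ξ : Fin k → ℝ)
    (V : Submodule ℝ (Lp ℝ 2 (volume.restrict (Set.Ioo (-1 : ℝ) 1))))
    (hV : Module.finrank ℝ V = n + 1) :
    ∃ f ∈ V, f ≠ 0 ∧ ∀ j, hartley c f (ξ j) = 0 := by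
  have hint : ∀ f : Lp ℝ 2 (volume.restrict (Set.Ioo (-1 : ℝ) 1)),
      IntegrableOn f (Set.Ioo (-1 : ℝ) 1) := fun f => (Lp.memLp f).integrable (by norm_num)
  let φ : V →ₗ[ℝ] (Fin k → ℝ) :=
    { toFun := fun f j => hartley c (f : Lp ℝ 2 (volume.restrict (Set.Ioo (-1 : ℝ) 1))) (ξ j)
      map_add' := fun f g => by
        ext j
        simp only [hartley, Pi.add_apply]
        rw [← integral_add (integrable_cas_mul (hint _) _) (integrable_cas_mul (hint _) _)]
        refine integral_congr_ae ?_
        filter_upwards [Lp.coeFn_add f.1 g.1] with x hx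
        simp only [Submodule.coe_add, hx, Pi.add_apply]
        ring
      map_smul' := fun r f => by
        ext j
        simp only [hartley, Pi.smul_apply, RingHom.id_apply, smul_eq_mul]
        rw [← integral_const_mul]
        refine integral_congr_ae ?_
        filter_upwards [Lp.coeFn_smul r f.1] with x hx
        simp only [Submodule.coe_smul, hx, Pi.smul_apply, smul_eq_mul]
        ring }
  have : FiniteDimensional ℝ V := Module.finite_of_finrank_pos (by omega)
  have hker : φ.ker ≠ ⊥ := LinearMap.ker_ne_bot_of_finrank_lt (by simp; omega)
  obtain ⟨f, hf, hf0⟩ := Submodule.exists_mem_ne_zero_of_ne_bot hker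
  exact ⟨f, f.2, by simpa using hf0, fun j => congrFun (LinearMap.mem_ker.1 hf) j⟩

theorem integral_abs_sq_le (f : Lp ℝ 2 (volume.restrict (Set.Ioo (-1 : ℝ) 1))) :
    (∫ x in Set.Ioo (-1 : ℝ) 1, |f x|) ^ 2 ≤ 2 * ‖f‖ ^ 2 := by
  have h2 : Integrable (fun x => |f x| ^ 2) (volume.restrict (Set.Ioo (-1 : ℝ) 1)) := by
    simpa using (Lp.memLp f).integrable_norm_pow (by norm_num)
  have h1 : Integrable (fun x => |f x|) (volume.restrict (Set.Ioo (-1 : ℝ) 1)) :=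
    ((Lp.memLp f).integrable (by norm_num : (1 : ENNReal) ≤ 2)).abs
  have hn : ‖f‖ ^ 2 = ∫ x in Set.Ioo (-1 : ℝ) 1, |f x| ^ 2 := by
    rw [← real_inner_self_eq_norm_sq, L2.inner_def]
    refine integral_congr_ae (Filter.Eventually.of_forall fun x => ?_)
    simp [sq]
  set I := ∫ x in Set.Ioo (-1 : ℝ) 1, |f x| with hI
  have h3 : 0 ≤ ∫ x in Set.Ioo (-1 : ℝ) 1, (|f x| - I / 2) ^ 2 :=
    integral_nonneg fun x => sq_nonneg _
  have h4 : ∫ x in Set.Ioo (-1 : ℝ) 1, (|f x| - I / 2) ^ 2 =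
      ‖f‖ ^ 2 - I * I + 2 * (I / 2) ^ 2 := by
    have h5 : Integrable (fun x => |f x| ^ 2 - I * |f x|) (volume.restrict (Set.Ioo (-1 : ℝ) 1)) :=
      h2.sub (h1.const_mul I)
    have : ∀ x, (|f x| - I / 2) ^ 2 = |f x| ^ 2 - I * |f x| + (I / 2) ^ 2 := fun x => by ring
    simp only [this]
    rw [integral_add h5 (integrable_const _), integral_sub h2 (h1.const_mul I),
      integral_const_mul, hn, integral_const]
    simp only [Measure.real]
    simp
    norm_num
    exact Or.inl hI.symm
  nlinarith

theorem lambda_le_of_casDet_cons_le {n k : ℕ} (hk : k ≤ n) {c B : ℝ} (hc : 0 < c)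
    {x ξ : Fin k → ℝ} (hD : casDet c x ξ ≠ 0)
    (h : ∀ a ∈ Set.Icc (-1 : ℝ) 1, ∀ b ∈ Set.Icc (-1 : ℝ) 1,
      |casDet c (Fin.cons a x) (Fin.cons b ξ)| ≤ B * |casDet c x ξ|) :
    lambda n c ≤ 2 * c / Real.pi * B ^ 2 := by
  have hR : 0 ≤ 2 * c / Real.pi * B ^ 2 := by positivity
  refine Real.iSup_le (fun V => ?_) hR
  obtain ⟨f, hfV, hf0, hf⟩ := exists_mem_hartley_eq_zero hk c ξ V.1 V.2
  have hint : IntegrableOn f (Set.Ioo (-1 : ℝ) 1) := (Lp.memLp f).integrable (by norm_num)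
  have hpt : ∀ b ∈ Set.Ioo (-1 : ℝ) 1, hartley c f b ^ 2 ≤ B ^ 2 * (2 * ‖f‖ ^ 2) := by
    intro b hb
    obtain ⟨α, hα⟩ := casDet_cons_row c x ξ b
    have e1 : casDet c x ξ * hartley c f b =
        ∫ a in Set.Ioo (-1 : ℝ) 1, casDet c (Fin.cons a x) (Fin.cons b ξ) * f a := by
      have h1 : ∀ a, casDet c (Fin.cons a x) (Fin.cons b ξ) * f a =
          casDet c x ξ * (cas (c * a * b) * f a) + ∑ j, α j * (cas (c * a * ξ j) * f a) := by
        intro a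
        rw [hα, add_mul, Finset.sum_mul, mul_assoc]
        simp only [mul_assoc (α _)]
      have h2 : ∀ j, ∫ a in Set.Ioo (-1 : ℝ) 1, cas (c * a * ξ j) * f a = 0 := hf
      simp only [h1]
      rw [integral_add ((integrable_cas_mul hint b).const_mul _)
        (integrable_finsetSum _ fun j _ => (integrable_cas_mul hint (ξ j)).const_mul _),
        integral_finsetSum _ fun j _ => (integrable_cas_mul hint (ξ j)).const_mul _]
      simp [integral_const_mul, h2, hartley]
    have e2 : |casDet c x ξ * hartley c f b| ≤
        B * |casDet c x ξ| * ∫ a in Set.Ioo (-1 : ℝ) 1, |f a| := by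
      rw [e1, ← integral_const_mul, ← Real.norm_eq_abs (∫ _ in _, _)]
      refine norm_integral_le_of_norm_le (hint.abs.const_mul _) ?_
      filter_upwards [ae_restrict_mem measurableSet_Ioo] with a ha
      rw [norm_mul]
      exact mul_le_mul_of_nonneg_right (h a (Set.Ioo_subset_Icc_self ha) b
        (Set.Ioo_subset_Icc_self hb)) (abs_nonneg _)
    have hD' : 0 < |casDet c x ξ| := abs_pos.2 hD
    have e3 : |hartley c f b| ≤ B * ∫ a in Set.Ioo (-1 : ℝ) 1, |f a| := by
      rw [abs_mul] at e2
      refine le_of_mul_le_mul_left (e2.trans (le_of_eq ?_)) hD'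
      ring
    rw [← sq_abs]
    calc _ ≤ (B * ∫ a in Set.Ioo (-1 : ℝ) 1, |f a|) ^ 2 := by gcongr
      _ = B ^ 2 * (∫ a in Set.Ioo (-1 : ℝ) 1, |f a|) ^ 2 := by ring
      _ ≤ _ := by gcongr; exact integral_abs_sq_le f
  have hQ : QForm c f ≤ 2 * c / Real.pi * B ^ 2 * ‖f‖ ^ 2 := by
    rw [QForm_eq hc hint]
    have h1 : ∫ ξ in Set.Ioo (-1 : ℝ) 1, hartley c f ξ ^ 2 ≤ 2 * (B ^ 2 * (2 * ‖f‖ ^ 2)) := by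
      have := norm_setIntegral_le_of_norm_le_const (μ := volume) (s := Set.Ioo (-1 : ℝ) 1)
        (f := fun ξ => hartley c f ξ ^ 2) (C := B ^ 2 * (2 * ‖f‖ ^ 2)) (by simp)
        (fun b hb => by
          rw [Real.norm_of_nonneg (sq_nonneg _)]
          exact hpt b hb)
      refine (le_abs_self _).trans (this.trans (le_of_eq ?_))
      simp [Measure.real]
      ring_nf
    calc _ ≤ c / (2 * Real.pi) * (2 * (B ^ 2 * (2 * ‖f‖ ^ 2))) := by gcongr
      _ = _ := by field_simp
  have hnorm : 0 < ‖f‖ ^ 2 := by positivity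
  by_cases hbdd : BddBelow (Set.range fun f : {f : Lp ℝ 2 (volume.restrict (Set.Ioo (-1:ℝ) 1)) //
      f ∈ V.1 ∧ f ≠ 0} => QForm c (f.1 : ℝ → ℝ) / ‖f.1‖ ^ 2)
  · exact (ciInf_le hbdd ⟨f, hfV, hf0⟩).trans ((div_le_iff₀ hnorm).2 hQ)
  · rw [iInf, Real.sInf_of_not_bddBelow hbdd]
    exact hR

section Rodrigues

open Polynomial

/-- The `j`-th derivative of the polynomial `(1 - X ^ 2) ^ k`. -/
noncomputable def rodrigues (k j : ℕ) : ℝ[X] := derivative^[j] ((1 - X ^ 2) ^ k)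

theorem derivative_rodrigues (k j : ℕ) : derivative (rodrigues k j) = rodrigues k (j + 1) :=
  (Function.iterate_succ_apply' _ _ _).symm

theorem eval_rodrigues_eq_zero {k j : ℕ} (h : j < k) {x : ℝ} (hx : x ^ 2 = 1) :
    (rodrigues k j).eval x = 0 := by
  obtain ⟨r, hr⟩ := pow_sub_dvd_iterate_derivative_of_pow_dvd j
    (dvd_refl ((1 - X ^ 2 : ℝ[X]) ^ k))
  rw [rodrigues, hr]
  simp [hx, Nat.sub_ne_zero_of_lt h]

theorem integral_rodrigues_succ_mul {k j : ℕ} (h : j < k) {v v' : ℝ → ℝ}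
    (hv : ∀ x, HasDerivAt v (v' x) x) (hv' : Continuous v') :
    ∫ x in (-1 : ℝ)..1, (rodrigues k (j + 1)).eval x * v x =
      -∫ x in (-1 : ℝ)..1, (rodrigues k j).eval x * v' x := by
  rw [intervalIntegral.integral_mul_deriv_eq_deriv_mul
    (u := fun x => (rodrigues k j).eval x) (u' := fun x => (rodrigues k (j + 1)).eval x)
    (fun x _ => by rw [← derivative_rodrigues]; exact (rodrigues k j).hasDerivAt x)
    (fun x _ => hv x) ((Polynomial.continuous _).intervalIntegrable _ _)
    (hv'.intervalIntegrable _ _)]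
  simp [eval_rodrigues_eq_zero h]

theorem integral_rodrigues_mul_eval {k j : ℕ} (h : j ≤ k) (g : ℝ[X]) :
    ∫ x in (-1 : ℝ)..1, (rodrigues k j).eval x * g.eval x =
      (-1) ^ j * ∫ x in (-1 : ℝ)..1, (1 - x ^ 2) ^ k * (derivative^[j] g).eval x := by
  induction j generalizing g with
  | zero => simp [rodrigues]
  | succ j ih =>
    rw [integral_rodrigues_succ_mul (v := fun x => g.eval x)
      (v' := fun x => (derivative g).eval x) (by omega) (fun x => g.hasDerivAt x)
      (Polynomial.continuous _), ih (by omega), Function.iterate_succ_apply, pow_succ]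
    ring

theorem iterate_derivative_eq_C {p : ℝ[X]} {n : ℕ} (h : p.natDegree ≤ n) :
    derivative^[n] p = C (n.factorial * p.coeff n) := by
  ext m
  rw [coeff_iterate_derivative, coeff_C]
  split_ifs with hm
  · simp [hm, Nat.descFactorial_self]
  · rw [coeff_eq_zero_of_natDegree_lt (by omega), smul_zero]

/-- The weighted cosine transform `∫ (1 - x ^ 2) ^ k cos (y x)` over `[-1, 1]`. -/
noncomputable def cosTransform (k : ℕ) (y : ℝ) : ℝ :=
  ∫ x in (-1 : ℝ)..1, (1 - x ^ 2) ^ k * Real.cos (y * x)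

theorem cosTransform_zero (k : ℕ) : cosTransform k 0 = ∫ x in (-1 : ℝ)..1, (1 - x ^ 2) ^ k := by
  simp [cosTransform]

theorem cosTransform_neg (k : ℕ) (y : ℝ) : cosTransform k (-y) = cosTransform k y := by
  simp [cosTransform]

theorem integral_odd_eq_zero {f : ℝ → ℝ} (hf : ∀ x, f (-x) = -f x) :
    ∫ x in (-1 : ℝ)..1, f x = 0 := by
  have := intervalIntegral.integral_comp_neg (a := -1) (b := 1) f
  simp only [hf, intervalIntegral.integral_neg, neg_neg] at this
  linarith

theorem exists_integral_rodrigues_mul_cas {k j : ℕ} (h : j ≤ k) :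
    ∃ s : ℝ, s ^ 2 = 1 ∧ ∀ y, ∫ x in (-1 : ℝ)..1, (rodrigues k j).eval x * cas (y * x) =
      s * y ^ j * cosTransform k y := by
  induction j with
  | zero =>
    refine ⟨1, by norm_num, fun y => ?_⟩
    have h0 : ∫ x in (-1 : ℝ)..1, (1 - x ^ 2) ^ k * Real.sin (y * x) = 0 :=
      integral_odd_eq_zero fun x => by simp
    simp only [rodrigues, Function.iterate_zero, id, cas, mul_add, eval_pow, eval_sub, eval_one,
      eval_X]
    rw [intervalIntegral.integral_add (Continuous.intervalIntegrable (by fun_prop) _ _)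
      (Continuous.intervalIntegrable (by fun_prop) _ _), h0]
    simp [cosTransform]
  | succ j ih =>
    obtain ⟨s, hs, hI⟩ := ih (by omega)
    refine ⟨-(-1) ^ j * s, by rw [mul_pow, hs, neg_sq, ← pow_mul, mul_comm j 2]; simp, fun y => ?_⟩
    have hv : ∀ x, HasDerivAt (fun x => cas (y * x)) (y * cas (-y * x)) x := by
      intro x
      have h1 := ((hasDerivAt_id x).const_mul y).cos.add ((hasDerivAt_id x).const_mul y).sin
      refine h1.congr_deriv ?_
      simp [cas]
      ring
    rw [integral_rodrigues_succ_mul (by omega) hv (by fun_prop)]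
    simp only [mul_left_comm _ y]
    rw [intervalIntegral.integral_const_mul, hI, cosTransform_neg, neg_pow y]
    ring

theorem natDegree_one_sub_X_sq_pow_le (k : ℕ) : ((1 - X ^ 2 : ℝ[X]) ^ k).natDegree ≤ 2 * k := by
  refine natDegree_pow_le.trans ?_
  rw [mul_comm 2 k]
  exact Nat.mul_le_mul_left _ (by compute_degree)

theorem abs_coeff_one_sub_X_sq_pow (k : ℕ) : |((1 - X ^ 2 : ℝ[X]) ^ k).coeff (2 * k)| = 1 := by
  have h : (1 - X ^ 2 : ℝ[X]).coeff 2 = -1 := by simp [coeff_one]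
  rw [mul_comm, coeff_pow_of_natDegree_le (by compute_degree), h]
  simp

theorem integral_rodrigues_sq (k : ℕ) :
    ∫ x in (-1 : ℝ)..1, (rodrigues k k).eval x ^ 2 = (2 * k).factorial * cosTransform k 0 := by
  have h0 : 0 ≤ cosTransform k 0 := by
    rw [cosTransform_zero]
    refine intervalIntegral.integral_nonneg (by norm_num) fun x hx => pow_nonneg ?_ _
    nlinarith [hx.1, hx.2]
  have h1 : 0 ≤ ∫ x in (-1 : ℝ)..1, (rodrigues k k).eval x ^ 2 :=
    intervalIntegral.integral_nonneg (by norm_num) fun x _ => sq_nonneg _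
  rw [← abs_of_nonneg h1]
  simp only [sq]
  rw [integral_rodrigues_mul_eval le_rfl, rodrigues, ← Function.iterate_add_apply, ← two_mul,
    iterate_derivative_eq_C (natDegree_one_sub_X_sq_pow_le k)]
  simp only [eval_C]
  rw [intervalIntegral.integral_mul_const, ← cosTransform_zero, abs_mul, abs_mul, abs_mul,
    abs_coeff_one_sub_X_sq_pow, abs_of_nonneg h0]
  simp [mul_comm]

/-- The `L¹` norm on `[-1, 1]` of the `k`-th derivative of `(1 - X ^ 2) ^ k`. -/
noncomputable def rodriguesNorm (k : ℕ) : ℝ := ∫ x in (-1 : ℝ)..1, |(rodrigues k k).eval x|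

theorem sq_integral_le {f : ℝ → ℝ} (hf : Continuous f) :
    (∫ x in (-1 : ℝ)..1, f x) ^ 2 ≤ 2 * ∫ x in (-1 : ℝ)..1, f x ^ 2 := by
  set I := ∫ x in (-1 : ℝ)..1, f x with hI
  have h3 : 0 ≤ ∫ x in (-1 : ℝ)..1, (f x - I / 2) ^ 2 :=
    intervalIntegral.integral_nonneg (by norm_num) fun x _ => sq_nonneg _
  have h4 : ∫ x in (-1 : ℝ)..1, (f x - I / 2) ^ 2 =
      (∫ x in (-1 : ℝ)..1, f x ^ 2) - I * I + 2 * (I / 2) ^ 2 := by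
    have : ∀ x, (f x - I / 2) ^ 2 = f x ^ 2 - I * f x + (I / 2) ^ 2 := fun x => by ring
    simp only [this]
    rw [intervalIntegral.integral_add (Continuous.intervalIntegrable (by fun_prop) _ _)
      (Continuous.intervalIntegrable (by fun_prop) _ _), intervalIntegral.integral_sub
      (Continuous.intervalIntegrable (by fun_prop) _ _)
      (Continuous.intervalIntegrable (by fun_prop) _ _), intervalIntegral.integral_const_mul,
      ← hI, intervalIntegral.integral_const]
    simp
    norm_num
  nlinarith

theorem rodriguesNorm_sq_le (k : ℕ) :
    rodriguesNorm k ^ 2 ≤ 2 * (4 ^ k * (k.factorial : ℝ) ^ 2 * cosTransform k 0) := by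
  have h0 : 0 ≤ cosTransform k 0 := by
    rw [cosTransform_zero]
    refine intervalIntegral.integral_nonneg (by norm_num) fun x hx => pow_nonneg ?_ _
    nlinarith [hx.1, hx.2]
  refine (sq_integral_le (by fun_prop)).trans ?_
  simp only [sq_abs]
  rw [integral_rodrigues_sq]
  gcongr
  have h1 : (2 * k).factorial ≤ 4 ^ k * k.factorial ^ 2 := by
    have := Nat.choose_mul_factorial_mul_factorial (show k ≤ 2 * k by omega)
    rw [show 2 * k - k = k by omega, mul_assoc, ← sq] at this
    rw [← this]
    refine Nat.mul_le_mul_right _ ?_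
    rw [show 4 ^ k = 2 ^ (2 * k) by rw [pow_mul]; norm_num]
    exact Nat.choose_le_two_pow _ _
  exact_mod_cast h1

theorem abs_eval_rodrigues_le {k i : ℕ} (h : i + 1 ≤ k) {x : ℝ} (hx : x ∈ Set.Icc (-1 : ℝ) 1) :
    |(rodrigues k (k - (i + 1))).eval x| ≤ rodriguesNorm k * ((x + 1) ^ i / i.factorial) := by
  have key : ∀ j < k, ∀ x, ∫ t in (-1 : ℝ)..x, (rodrigues k (j + 1)).eval t =
      (rodrigues k j).eval x := by
    intro j hj x
    rw [intervalIntegral.integral_eq_sub_of_hasDerivAt (f := fun x => (rodrigues k j).eval x)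
      (fun x _ => by rw [← derivative_rodrigues]; exact (rodrigues k j).hasDerivAt x)
      ((Polynomial.continuous _).intervalIntegrable _ _),
      eval_rodrigues_eq_zero hj (x := -1) (by norm_num), sub_zero]
  induction i generalizing x with
  | zero =>
    rw [← key _ (by omega), show k - (0 + 1) + 1 = k by omega]
    simp only [pow_zero, Nat.factorial_zero, Nat.cast_one, div_one, mul_one]
    refine (intervalIntegral.abs_integral_le_integral_abs hx.1).trans ?_
    exact intervalIntegral.integral_mono_interval le_rfl hx.1 hx.2
      (Filter.Eventually.of_forall fun x => abs_nonneg _)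
      (Continuous.intervalIntegrable (by fun_prop) _ _)
  | succ i ih =>
    rw [← key _ (by omega), show k - (i + 1 + 1) + 1 = k - (i + 1) by omega]
    refine (intervalIntegral.abs_integral_le_integral_abs hx.1).trans ?_
    have h1 : ∫ t in (-1 : ℝ)..x, rodriguesNorm k * ((t + 1) ^ i / i.factorial) =
        rodriguesNorm k * ((x + 1) ^ (i + 1) / (i + 1).factorial) := by
      rw [intervalIntegral.integral_const_mul, intervalIntegral.integral_div,
        intervalIntegral.integral_comp_add_right (fun t => t ^ i), integral_pow,
        Nat.factorial_succ]
      simp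
      field_simp
      simp
    rw [← h1]
    exact intervalIntegral.integral_mono_on hx.1 (Continuous.intervalIntegrable (by fun_prop) _ _)
      (Continuous.intervalIntegrable (by fun_prop) _ _)
      fun t ht => ih (by omega) ⟨ht.1, ht.2.trans hx.2⟩

theorem rodriguesNorm_nonneg (k : ℕ) : 0 ≤ rodriguesNorm k :=
  intervalIntegral.integral_nonneg (by norm_num) fun x _ => abs_nonneg _

theorem integral_abs_rodrigues_le {k i : ℕ} (h : i ≤ k) :
    ∫ x in (-1 : ℝ)..1, |(rodrigues k (k - i)).eval x| ≤
      rodriguesNorm k * (4 ^ i / i.factorial) := by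
  cases i with
  | zero => simp [rodriguesNorm]
  | succ i =>
    have h1 : ∫ x in (-1 : ℝ)..1, |(rodrigues k (k - (i + 1))).eval x| ≤
        ∫ x in (-1 : ℝ)..1, rodriguesNorm k * (2 ^ i / i.factorial) := by
      refine intervalIntegral.integral_mono_on (by norm_num)
        (Continuous.intervalIntegrable (by fun_prop) _ _)
        (Continuous.intervalIntegrable (by fun_prop) _ _) fun x hx => ?_
      refine (abs_eval_rodrigues_le h hx).trans ?_
      have := rodriguesNorm_nonneg k
      have h2 : 0 ≤ x + 1 := by linarith [hx.1]
      have h3 : x + 1 ≤ 2 := by linarith [hx.2]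
      gcongr
    refine h1.trans ?_
    rw [intervalIntegral.integral_const, smul_eq_mul]
    have h2 : (2 : ℝ) ^ i / i.factorial * 2 ≤ 4 ^ (i + 1) / (i + 1).factorial := by
      rw [div_mul_eq_mul_div, div_le_div_iff₀ (by positivity) (by positivity), Nat.factorial_succ]
      have h3 : ((i + 1 : ℕ) : ℝ) ≤ 2 ^ (i + 1) := by
        exact_mod_cast (Nat.lt_two_pow_self).le
      calc (2 : ℝ) ^ i * 2 * ((i + 1) * i.factorial : ℕ)
          = 2 ^ (i + 1) * ((i + 1 : ℕ) : ℝ) * i.factorial := by push_cast; ring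
        _ ≤ 2 ^ (i + 1) * 2 ^ (i + 1) * i.factorial := by gcongr
        _ = _ := by rw [← mul_pow]; norm_num
    calc _ = rodriguesNorm k * ((2 : ℝ) ^ i / i.factorial * 2) := by ring
      _ ≤ _ := mul_le_mul_of_nonneg_left h2 (rodriguesNorm_nonneg k)

theorem sum_choose_mul_le {k : ℕ} {t : ℝ} (ht : 0 ≤ t) :
    ∑ i ∈ Finset.range (k + 1), (k.choose i : ℝ) * (t ^ i / i.factorial) ≤
      Real.exp (2 * Real.sqrt (t * k)) := by
  set r := Real.sqrt (t * k) with hr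
  have hr0 : 0 ≤ r := Real.sqrt_nonneg _
  have h1 : ∀ i ∈ Finset.range (k + 1), (k.choose i : ℝ) * (t ^ i / i.factorial) ≤
      (r ^ i / i.factorial) ^ 2 := by
    intro i _
    calc (k.choose i : ℝ) * (t ^ i / i.factorial)
        ≤ ((k : ℝ) ^ i / i.factorial) * (t ^ i / i.factorial) := by
          gcongr
          exact Nat.choose_le_pow_div _ _
      _ = (t * k) ^ i / (i.factorial : ℝ) ^ 2 := by rw [mul_pow]; ring
      _ = _ := by rw [div_pow, ← pow_mul, mul_comm i 2, pow_mul, hr, Real.sq_sqrt (by positivity)]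
  calc _ ≤ ∑ i ∈ Finset.range (k + 1), (r ^ i / i.factorial) ^ 2 := Finset.sum_le_sum h1
    _ ≤ (∑ i ∈ Finset.range (k + 1), r ^ i / i.factorial) ^ 2 :=
      Finset.sum_sq_le_sq_sum_of_nonneg fun i _ => by positivity
    _ ≤ (Real.exp r) ^ 2 := by
      gcongr
      exact Real.sum_le_exp_of_nonneg hr0 _
    _ = _ := by rw [← Real.exp_nat_mul]; norm_num

theorem cosTransform_add_two (k : ℕ) (y : ℝ) :
    4 * (k + 2) * (k + 1) * cosTransform k y - 2 * (k + 2) * (2 * k + 3) * cosTransform (k + 1) y +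
      y ^ 2 * cosTransform (k + 2) y = 0 := by
  have hd : ∀ x : ℝ, HasDerivAt (fun x => -2 * (k + 2) * x * (1 - x ^ 2) ^ (k + 1) * Real.cos (y * x) +
      y * (1 - x ^ 2) ^ (k + 2) * Real.sin (y * x))
      (4 * (k + 2) * (k + 1) * ((1 - x ^ 2) ^ k * Real.cos (y * x)) -
        2 * (k + 2) * (2 * k + 3) * ((1 - x ^ 2) ^ (k + 1) * Real.cos (y * x)) +
        y ^ 2 * ((1 - x ^ 2) ^ (k + 2) * Real.cos (y * x))) x := by
    intro x
    have e1 : ∀ m : ℕ, HasDerivAt (fun x : ℝ => (1 - x ^ 2) ^ (m + 1))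
        ((m + 1 : ℕ) * (1 - x ^ 2) ^ m * -(2 * x)) x := fun m => by
      simpa using ((hasDerivAt_pow 2 x).const_sub 1).fun_pow (m + 1)
    have e2 : HasDerivAt (fun x => Real.cos (y * x)) (-Real.sin (y * x) * y) x := by
      simpa using ((hasDerivAt_id x).const_mul y).cos
    have e3 : HasDerivAt (fun x => Real.sin (y * x)) (Real.cos (y * x) * y) x := by
      simpa using ((hasDerivAt_id x).const_mul y).sin
    have e4 : HasDerivAt (fun x : ℝ => -2 * ((k : ℝ) + 2) * x) (-2 * (k + 2)) x := by
      simpa using (hasDerivAt_id x).const_mul (-2 * ((k : ℝ) + 2))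
    refine (((e4.fun_mul (e1 k)).fun_mul e2).fun_add
      (((e1 (k + 1)).const_mul y).fun_mul e3)).congr_deriv ?_
    push_cast
    ring
  have h := intervalIntegral.integral_eq_sub_of_hasDerivAt (a := -1) (b := 1) (fun x _ => hd x)
    (Continuous.intervalIntegrable (by fun_prop) _ _)
  rw [intervalIntegral.integral_add (Continuous.intervalIntegrable (by fun_prop) _ _)
    (Continuous.intervalIntegrable (by fun_prop) _ _), intervalIntegral.integral_sub
    (Continuous.intervalIntegrable (by fun_prop) _ _)
    (Continuous.intervalIntegrable (by fun_prop) _ _)] at h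
  simp only [intervalIntegral.integral_const_mul] at h
  simpa [cosTransform] using h

theorem cosTransform_succ_zero (k : ℕ) :
    (2 * k + 3) * cosTransform (k + 1) 0 = (2 * k + 2) * cosTransform k 0 := by
  have h := cosTransform_add_two k 0
  have h2 : ((k : ℝ) + 2) ≠ 0 := by positivity
  refine mul_left_cancel₀ h2 ?_
  linarith

theorem one_div_le_cosTransform_zero (k : ℕ) : 1 / ((k : ℝ) + 1) ≤ cosTransform k 0 := by
  induction k with
  | zero => norm_num [cosTransform]
  | succ k ih =>
    have h := cosTransform_succ_zero k
    have h1 : cosTransform (k + 1) 0 = (2 * k + 2) / (2 * k + 3) * cosTransform k 0 := by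
      field_simp
      linarith
    rw [h1]
    refine le_trans ?_ (mul_le_mul_of_nonneg_left ih (by positivity))
    push_cast
    rw [div_mul_div_comm, div_le_div_iff₀ (by positivity) (by positivity)]
    nlinarith [Nat.cast_nonneg (α := ℝ) k]

theorem cosTransform_zero_pos (k : ℕ) : 0 < cosTransform k 0 :=
  lt_of_lt_of_le (by positivity) (one_div_le_cosTransform_zero k)

theorem cosTransform_le (k : ℕ) (y : ℝ) : cosTransform k y ≤ cosTransform k 0 := by
  rw [cosTransform_zero]
  refine intervalIntegral.integral_mono_on (by norm_num)
    (Continuous.intervalIntegrable (by fun_prop) _ _)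
    (Continuous.intervalIntegrable (by fun_prop) _ _) fun x hx => ?_
  refine mul_le_of_le_one_right (pow_nonneg ?_ _) (Real.cos_le_one _)
  nlinarith [hx.1, hx.2]

theorem le_cosTransform (k : ℕ) (y : ℝ) :
    cosTransform k 0 * (1 - y ^ 2 / (2 * (2 * k + 3))) ≤ cosTransform k y := by
  have h1 : ∫ x in (-1 : ℝ)..1, ((1 - y ^ 2 / 2) * (1 - x ^ 2) ^ k +
      y ^ 2 / 2 * (1 - x ^ 2) ^ (k + 1)) ≤ cosTransform k y := by
    refine intervalIntegral.integral_mono_on (by norm_num)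
      (Continuous.intervalIntegrable (by fun_prop) _ _)
      (Continuous.intervalIntegrable (by fun_prop) _ _) fun x hx => ?_
    have h2 : 0 ≤ 1 - x ^ 2 := by nlinarith [hx.1, hx.2]
    calc _ = (1 - x ^ 2) ^ k * (1 - (y * x) ^ 2 / 2) := by ring
      _ ≤ _ := by
        gcongr
        exact Real.one_sub_sq_div_two_le_cos
  rw [intervalIntegral.integral_add (Continuous.intervalIntegrable (by fun_prop) _ _)
    (Continuous.intervalIntegrable (by fun_prop) _ _), intervalIntegral.integral_const_mul,
    intervalIntegral.integral_const_mul, ← cosTransform_zero, ← cosTransform_zero] at h1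
  refine le_trans (le_of_eq ?_) h1
  have h3 : cosTransform (k + 1) 0 = (2 * k + 2) / (2 * k + 3) * cosTransform k 0 := by
    have := cosTransform_succ_zero k
    field_simp
    linarith
  rw [h3]
  field_simp
  ring

/-- The transform `cosTransform` normalised to take the value `1` at the origin. -/
noncomputable def cosRatio (k : ℕ) (y : ℝ) : ℝ := cosTransform k y / cosTransform k 0

theorem cosRatio_eq (k : ℕ) (y : ℝ) : cosRatio k y =
    cosRatio (k + 1) y - y ^ 2 / ((2 * k + 3) * (2 * k + 5)) * cosRatio (k + 2) y := by
  have h0 := cosTransform_zero_pos k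
  have h3 : cosTransform (k + 1) 0 = (2 * k + 2) / (2 * k + 3) * cosTransform k 0 := by
    have := cosTransform_succ_zero k
    field_simp
    linarith
  have h4 : cosTransform (k + 2) 0 =
      (2 * k + 4) / (2 * k + 5) * ((2 * k + 2) / (2 * k + 3) * cosTransform k 0) := by
    rw [← h3]
    have := cosTransform_succ_zero (k + 1)
    push_cast at this
    field_simp
    linarith
  have h := cosTransform_add_two k y
  unfold cosRatio
  rw [h3, h4]
  field_simp
  linarith

theorem one_sub_ge_exp {a : ℝ} (h0 : 0 ≤ a) (h1 : a ≤ 1 / 4) : Real.exp (-(4 * a)) ≤ 1 - 2 * a := by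
  rw [Real.exp_neg, inv_le_comm₀ (Real.exp_pos _) (by linarith)]
  refine le_trans ?_ (Real.add_one_le_exp (4 * a))
  rw [inv_le_iff_one_le_mul₀ (by linarith)]
  nlinarith

theorem cosRatio_bounds {k : ℕ} {y : ℝ} (hy : |y| ≤ k + 1) {J : ℕ} (hJ : y ^ 2 ≤ 2 * J + 3) (d : ℕ) :
    ∀ j, k ≤ j → J ≤ j + d → 1 / 2 * Real.exp (-(2 * y ^ 2 / (2 * j + 3))) ≤ cosRatio j y ∧
      cosRatio (j + 1) y ≤ 2 * cosRatio j y := by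
  induction d with
  | zero =>
    intro j _ hj
    have hJj : (J : ℝ) ≤ j := by exact_mod_cast hj
    have h1 : 1 / 2 ≤ cosRatio j y := by
      rw [cosRatio, le_div_iff₀ (cosTransform_zero_pos j)]
      refine le_trans ?_ (le_cosTransform j y)
      rw [mul_comm]
      refine mul_le_mul_of_nonneg_left ?_ (cosTransform_zero_pos j).le
      have : y ^ 2 / (2 * (2 * j + 3)) ≤ 1 / 2 := by
        rw [div_le_div_iff₀ (by positivity) (by norm_num)]
        linarith
      linarith
    have h2 : cosRatio (j + 1) y ≤ 1 := div_le_one_of_le₀ (cosTransform_le _ _)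
      (cosTransform_zero_pos _).le
    refine ⟨le_trans ?_ h1, by linarith⟩
    have : Real.exp (-(2 * y ^ 2 / (2 * j + 3))) ≤ 1 := Real.exp_le_one_iff.2 (by
      rw [neg_nonpos]
      positivity)
    linarith
  | succ d ih =>
    intro j hkj hj
    obtain ⟨h1, h2⟩ := ih (j + 1) (by omega) (by omega)
    have hkj' : (k : ℝ) ≤ j := by exact_mod_cast hkj
    set a := y ^ 2 / ((2 * (j : ℝ) + 3) * (2 * j + 5)) with ha
    have ha0 : 0 ≤ a := by positivity
    have ha1 : a ≤ 1 / 4 := by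
      rw [ha, div_le_div_iff₀ (by positivity) (by norm_num), ← sq_abs]
      nlinarith [abs_nonneg y]
    have hpos : 0 < cosRatio (j + 1) y := lt_of_lt_of_le (by positivity) h1
    have h3 : (1 - 2 * a) * cosRatio (j + 1) y ≤ cosRatio j y := by
      rw [cosRatio_eq j y]
      nlinarith
    refine ⟨?_, by nlinarith⟩
    calc _ = Real.exp (-(4 * a)) * (1 / 2 * Real.exp (-(2 * y ^ 2 / (2 * (j + 1 : ℕ) + 3)))) := by
          rw [mul_left_comm, ← Real.exp_add, ha]
          congr 2
          push_cast
          field_simp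
          ring
      _ ≤ (1 - 2 * a) * cosRatio (j + 1) y :=
          mul_le_mul (one_sub_ge_exp ha0 ha1) h1 (by positivity) (by linarith)
      _ ≤ _ := h3

theorem le_cosTransform_of_le {k : ℕ} {t y : ℝ} (hy : |y| ≤ t) (ht : t ≤ k + 1) :
    cosTransform k 0 * (1 / 2 * Real.exp (-t)) ≤ cosTransform k y := by
  obtain ⟨J, hJ⟩ := exists_nat_ge (y ^ 2)
  have h := (cosRatio_bounds (J := J) (hy.trans ht) (by linarith [Nat.cast_nonneg (α := ℝ) J]) J
    k le_rfl (by omega)).1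
  have h1 : 2 * y ^ 2 / (2 * k + 3) ≤ t := by
    rw [div_le_iff₀ (by positivity), ← sq_abs]
    nlinarith [abs_nonneg y]
  rw [cosRatio, le_div_iff₀ (cosTransform_zero_pos k)] at h
  refine le_trans ?_ h
  rw [mul_comm]
  have := cosTransform_zero_pos k
  gcongr

end Rodrigues

open Polynomial in
theorem abs_coeff_prod_X_sub_C_le {k : ℕ} {x : Fin k → ℝ} (hx : ∀ i, |x i| ≤ 1) (j : ℕ) :
    |(∏ i, (X - C (x i)) : ℝ[X]).coeff j| ≤ k.choose j := by
  have h := coeff_le_of_roots_le (p := ∏ i, (X - C (x i))) (f := RingHom.id ℝ) (B := 1) j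
    (monic_prod_X_sub_C _ _) (by
      rw [Polynomial.map_id]
      exact Splits.prod fun i _ => Splits.X_sub_C _) (by
      intro z hz
      rw [Polynomial.map_id] at hz
      have := isRoot_of_mem_roots hz
      rw [IsRoot, eval_prod, Finset.prod_eq_zero_iff] at this
      obtain ⟨i, _, hi⟩ := this
      rw [eval_sub, eval_X, eval_C, sub_eq_zero] at hi
      rw [hi]
      exact hx i)
  simpa using h

open Polynomial in
theorem le_of_abs_casDet_cons_le {k : ℕ} {c t B : ℝ} (ht : 0 < t) (htc : t ≤ c) (htk : t ≤ k + 1)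
    {x ξ : Fin k → ℝ} (hx : ∀ i, |x i| ≤ 1) (hD : casDet c x ξ ≠ 0)
    (h : ∀ a ∈ Set.Icc (-1 : ℝ) 1, ∀ b ∈ Set.Icc (-1 : ℝ) 1,
      |casDet c (Fin.cons a x) (Fin.cons b ξ)| ≤ B * |casDet c x ξ|) :
    (t / 4) ^ k / k.factorial * (cosTransform k 0 / 4 * Real.exp (-t - 4 * Real.sqrt (t * k))) ≤
      B := by
  have hc : 0 < c := ht.trans_le htc
  have hB : 0 ≤ B := by
    have := h 0 (by norm_num) 0 (by norm_num)
    exact nonneg_of_mul_nonneg_left ((abs_nonneg _).trans this) (abs_pos.2 hD)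
  choose s hs hI using fun j : Fin (k + 1) =>
    exists_integral_rodrigues_mul_cas (k := k) (j := j) (by omega)
  set q : ℝ[X] := ∏ i, (X - C (x i)) with hq
  have hqm : q.Monic := monic_prod_X_sub_C _ _
  have hqd : q.natDegree = k := by simp [hq]
  set H : ℝ → ℝ := fun y => ∑ j : Fin (k + 1), q.coeff j * s j / t ^ (j : ℕ) *
    (rodrigues k j).eval y with hH
  have hHc : Continuous H := by fun_prop
  have hh : ∀ a, ∫ y in (-1 : ℝ)..1, cas (t * a * y) * H y = q.eval a * cosTransform k (t * a) := by
    intro a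
    have e1 : ∀ y, cas (t * a * y) * H y = ∑ j : Fin (k + 1), q.coeff j * s j / t ^ (j : ℕ) *
        ((rodrigues k j).eval y * cas (t * a * y)) := by
      intro y
      rw [hH, Finset.mul_sum]
      refine Finset.sum_congr rfl fun j _ => ?_
      ring
    simp only [e1]
    rw [intervalIntegral.integral_finsetSum fun j _ =>
      Continuous.intervalIntegrable (by fun_prop) _ _]
    simp only [intervalIntegral.integral_const_mul, hI]
    rw [eval_eq_sum_range' (n := k + 1) (by omega), ← Fin.sum_univ_eq_sum_range
      (fun j => q.coeff j * a ^ j), Finset.sum_mul]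
    refine Finset.sum_congr rfl fun j _ => ?_
    rw [mul_pow]
    have := hs j
    field_simp
    rw [this]
    ring
  have hHn : ∫ y in (-1 : ℝ)..1, |H y| ≤
      rodriguesNorm k / t ^ k * Real.exp (4 * Real.sqrt (t * k)) := by
    have e1 : ∫ y in (-1 : ℝ)..1, |H y| ≤ ∑ j : Fin (k + 1), (k.choose j : ℝ) / t ^ (j : ℕ) *
        ∫ y in (-1 : ℝ)..1, |(rodrigues k j).eval y| := by
      simp only [← intervalIntegral.integral_const_mul]
      rw [← intervalIntegral.integral_finsetSum fun j _ =>
        Continuous.intervalIntegrable (by fun_prop) _ _]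
      refine intervalIntegral.integral_mono_on (by norm_num)
        (Continuous.intervalIntegrable (by fun_prop) _ _)
        (Continuous.intervalIntegrable (by fun_prop) _ _) fun y _ => ?_
      refine (Finset.abs_sum_le_sum_abs _ _).trans (Finset.sum_le_sum fun j _ => ?_)
      have hsj : |s j| = 1 := by
        have := hs j
        rw [← sq_abs] at this
        nlinarith [abs_nonneg (s j)]
      rw [abs_mul, abs_div, abs_mul, hsj, mul_one, abs_of_pos (pow_pos ht _)]
      gcongr
      exact abs_coeff_prod_X_sub_C_le hx _
    refine e1.trans ?_
    rw [Fin.sum_univ_eq_sum_range (fun j => (k.choose j : ℝ) / t ^ j *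
      ∫ y in (-1 : ℝ)..1, |(rodrigues k j).eval y|), ← Finset.sum_range_reflect]
    have e2 : ∀ i ∈ Finset.range (k + 1), (k.choose (k + 1 - 1 - i) : ℝ) / t ^ (k + 1 - 1 - i) *
        ∫ y in (-1 : ℝ)..1, |(rodrigues k (k + 1 - 1 - i)).eval y| ≤
        rodriguesNorm k / t ^ k * ((k.choose i : ℝ) * ((4 * t) ^ i / i.factorial)) := by
      intro i hi
      have hik : i ≤ k := by simpa [Nat.lt_succ_iff] using hi
      rw [Nat.add_sub_cancel, Nat.choose_symm hik]
      refine (mul_le_mul_of_nonneg_left (integral_abs_rodrigues_le hik) (by positivity)).trans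
        (le_of_eq ?_)
      have : t ^ k = t ^ (k - i) * t ^ i := by rw [← pow_add]; congr 1; omega
      rw [this, mul_pow]
      field_simp
    refine (Finset.sum_le_sum e2).trans ?_
    rw [← Finset.mul_sum]
    refine mul_le_mul_of_nonneg_left ((sum_choose_mul_le (by positivity)).trans (le_of_eq ?_))
      (div_nonneg (rodriguesNorm_nonneg k) (by positivity))
    rw [mul_assoc 4 t, Real.sqrt_mul (by norm_num), show (4 : ℝ) = 2 ^ 2 by norm_num,
      Real.sqrt_sq (by norm_num)]
    ring_nf
  have hqB : ∀ a ∈ Set.Icc (-1 : ℝ) 1, |q.eval a| * (cosTransform k 0 * (1 / 2 * Real.exp (-t))) ≤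
      B * (rodriguesNorm k / t ^ k * Real.exp (4 * Real.sqrt (t * k))) := by
    intro a ha
    have hu : cosTransform k 0 * (1 / 2 * Real.exp (-t)) ≤ cosTransform k (t * a) :=
      le_cosTransform_of_le (by
        rw [abs_mul, abs_of_pos ht]
        exact mul_le_of_le_one_right ht.le (abs_le.2 ha)) htk
    obtain ⟨α, hα⟩ := casDet_cons_row c ξ x a
    have hr : ∀ b, c * (t / c * b) = t * b := fun b => by field_simp
    have e1 : casDet c x ξ * (q.eval a * cosTransform k (t * a)) =
        ∫ y in (-1 : ℝ)..1, casDet c (Fin.cons a x) (Fin.cons (t / c * y) ξ) * H y := by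
      have e2 : ∀ y, casDet c (Fin.cons a x) (Fin.cons (t / c * y) ξ) * H y =
          casDet c x ξ * (cas (t * a * y) * H y) +
            ∑ j, α j * (cas (t * x j * y) * H y) := by
        intro y
        rw [casDet_comm, hα, casDet_comm c ξ x, hr, add_mul, Finset.sum_mul, mul_assoc]
        simp only [mul_assoc (α _), mul_right_comm t y]
      simp only [e2]
      rw [intervalIntegral.integral_add (Continuous.intervalIntegrable (by fun_prop) _ _)
        (Continuous.intervalIntegrable (by fun_prop) _ _), intervalIntegral.integral_finsetSum
        fun j _ => Continuous.intervalIntegrable (by fun_prop) _ _]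
      simp only [intervalIntegral.integral_const_mul, hh]
      have : ∀ j, q.eval (x j) = 0 := fun j => by
        rw [hq, eval_prod]
        exact Finset.prod_eq_zero (Finset.mem_univ j) (by simp)
      simp [this]
    have e3 : |casDet c x ξ * (q.eval a * cosTransform k (t * a))| ≤
        B * |casDet c x ξ| * ∫ y in (-1 : ℝ)..1, |H y| := by
      rw [e1, ← intervalIntegral.integral_const_mul, ← Real.norm_eq_abs (∫ _ in _.._, _)]
      refine intervalIntegral.norm_integral_le_of_norm_le (by norm_num)
        (Filter.Eventually.of_forall fun y hy => ?_)
        (Continuous.intervalIntegrable (by fun_prop) _ _)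
      rw [norm_mul]
      refine mul_le_mul_of_nonneg_right (h a ha _ (abs_le.1 ?_)) (abs_nonneg _)
      rw [abs_mul, abs_of_pos (by positivity : 0 < t / c)]
      exact mul_le_one₀ ((div_le_one hc).2 htc) (abs_nonneg _) (abs_le.2 ⟨hy.1.le, hy.2⟩)
    have e4 : |q.eval a * cosTransform k (t * a)| ≤ B * ∫ y in (-1 : ℝ)..1, |H y| := by
      rw [abs_mul] at e3
      refine le_of_mul_le_mul_left (e3.trans (le_of_eq ?_)) (abs_pos.2 hD)
      ring
    calc _ ≤ |q.eval a| * cosTransform k (t * a) := by gcongr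
      _ ≤ |q.eval a| * |cosTransform k (t * a)| := by gcongr; exact le_abs_self _
      _ = |q.eval a * cosTransform k (t * a)| := (abs_mul _ _).symm
      _ ≤ _ := e4
      _ ≤ _ := by gcongr
  have hI0 := cosTransform_zero_pos k
  set J := rodriguesNorm k with hJ
  set S := Real.sqrt (t * k) with hS
  set E := cosTransform k 0 * (1 / 2 * Real.exp (-t)) with hE
  have hE0 : 0 < E := by positivity
  have hfin : k.factorial * cosTransform k 0 * E ≤
      B * (J / t ^ k * Real.exp (4 * S)) * J := by
    have e1 : |∫ y in (-1 : ℝ)..1, (rodrigues k k).eval y * q.eval y| =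
        k.factorial * cosTransform k 0 := by
      rw [integral_rodrigues_mul_eval le_rfl, iterate_derivative_eq_C hqd.le]
      have : q.coeff k = 1 := by rw [← hqd]; exact hqm.coeff_natDegree
      simp only [eval_C, this, mul_one]
      rw [intervalIntegral.integral_mul_const, ← cosTransform_zero, abs_mul, abs_mul,
        abs_of_pos hI0]
      simp [mul_comm]
    rw [← e1]
    have e2 : |∫ y in (-1 : ℝ)..1, (rodrigues k k).eval y * q.eval y| ≤
        ∫ y in (-1 : ℝ)..1, B * (J / t ^ k * Real.exp (4 * S)) / E * |(rodrigues k k).eval y| := by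
      rw [← Real.norm_eq_abs (∫ _ in _.._, _)]
      refine intervalIntegral.norm_integral_le_of_norm_le (by norm_num)
        (Filter.Eventually.of_forall fun y hy => ?_)
        (Continuous.intervalIntegrable (by fun_prop) _ _)
      rw [norm_mul, mul_comm]
      exact mul_le_mul_of_nonneg_right ((le_div_iff₀ hE0).2 (hqB y ⟨hy.1.le, hy.2⟩))
        (abs_nonneg _)
    rw [intervalIntegral.integral_const_mul, div_mul_eq_mul_div, le_div_iff₀ hE0] at e2
    exact e2
  have hJ2 := rodriguesNorm_sq_le k
  rw [← hJ] at hJ2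
  have h1 : k.factorial * cosTransform k 0 * E ≤ B * Real.exp (4 * S) / t ^ k *
      (2 * (4 ^ k * (k.factorial : ℝ) ^ 2 * cosTransform k 0)) := by
    refine hfin.trans (le_trans (le_of_eq ?_) (mul_le_mul_of_nonneg_left hJ2 (by positivity)))
    ring
  have h2 : Real.exp (-t - 4 * S) = Real.exp (-t) / Real.exp (4 * S) := Real.exp_sub _ _
  have hfac : (0 : ℝ) < k.factorial := by positivity
  have h3 : (k.factorial * cosTransform k 0 * 2 * 4 ^ k * k.factorial * Real.exp (4 * S) / t ^ k) *
      ((t / 4) ^ k / k.factorial * (cosTransform k 0 / 4 * Real.exp (-t - 4 * S))) ≤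
      (k.factorial * cosTransform k 0 * 2 * 4 ^ k * k.factorial * Real.exp (4 * S) / t ^ k) * B := by
    refine le_trans (le_of_eq ?_) (h1.trans (le_of_eq ?_))
    · rw [h2, hE, div_pow]
      field_simp
      ring
    · ring
  exact le_of_mul_le_mul_left h3 (by positivity)

theorem le_of_abs_casDet_cons_le' {k : ℕ} {c B : ℝ} (hc : 0 < c)
    {x ξ : Fin k → ℝ} (hx : ∀ i, |x i| ≤ 1) (hD : casDet c x ξ ≠ 0)
    (h : ∀ a ∈ Set.Icc (-1 : ℝ) 1, ∀ b ∈ Set.Icc (-1 : ℝ) 1,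
      |casDet c (Fin.cons a x) (Fin.cons b ξ)| ≤ B * |casDet c x ξ|) :
    (c / 4) ^ k / k.factorial * (Real.exp (-2 * c - 4 * Real.sqrt (c * k)) / (4 * (k + 1))) ≤
      B := by
  set t := min c (k + 1) with ht
  have ht0 : 0 < t := lt_min hc (by positivity)
  refine le_trans ?_ (le_of_abs_casDet_cons_le ht0 (min_le_left _ _) (min_le_right _ _) hx hD h)
  have h1 : c ^ k * Real.exp (-c) ≤ t ^ k := by
    rcases le_total c (k + 1) with h | h
    · rw [ht, min_eq_left h]
      exact mul_le_of_le_one_right (by positivity) (Real.exp_le_one_iff.2 (by linarith))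
    · rw [ht, min_eq_right h, Real.exp_neg, ← div_eq_mul_inv, div_le_iff₀ (Real.exp_pos _)]
      have h2 := Real.pow_div_factorial_le_exp c hc.le k
      rw [div_le_iff₀ (by positivity), mul_comm] at h2
      refine h2.trans (mul_le_mul_of_nonneg_right ?_ (Real.exp_pos _).le)
      exact_mod_cast (Nat.factorial_le_pow k).trans (Nat.pow_le_pow_left (Nat.le_succ k) k)
  have h2 : Real.exp (-c - 4 * Real.sqrt (c * k)) ≤ Real.exp (-t - 4 * Real.sqrt (t * k)) := by
    have htc : t ≤ c := min_le_left _ _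
    gcongr
  have h3 : Real.exp (-2 * c - 4 * Real.sqrt (c * k)) =
      Real.exp (-c) * Real.exp (-c - 4 * Real.sqrt (c * k)) := by
    rw [← Real.exp_add]
    ring_nf
  calc _ = (c ^ k * Real.exp (-c)) / 4 ^ k / k.factorial *
        (1 / ((k : ℝ) + 1) / 4 * Real.exp (-c - 4 * Real.sqrt (c * k))) := by
        rw [h3, div_pow]
        field_simp
    _ ≤ t ^ k / 4 ^ k / k.factorial *
        (cosTransform k 0 / 4 * Real.exp (-t - 4 * Real.sqrt (t * k))) := by
        have := cosTransform_zero_pos k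
        have := one_div_le_cosTransform_zero k
        gcongr
    _ = _ := by rw [div_pow]

theorem exists_prod_le_abs_casDet {n : ℕ} {c : ℝ} (hc : 0 < c) {w : ℕ → ℝ}
    (hw0 : ∀ k ≤ n, 0 < w k)
    (hw : ∀ k ≤ n, w k < (c / 4) ^ k / k.factorial *
      (Real.exp (-2 * c - 4 * Real.sqrt (c * k)) / (4 * (k + 1))) ∨
      2 * c / Real.pi * w k ^ 2 < lambda n c) (k : ℕ) (hk : k ≤ n + 1) :
    ∃ x ξ : Fin k → ℝ, (∀ i, |x i| ≤ 1) ∧ (∀ i, |ξ i| ≤ 1) ∧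
      ∏ i ∈ Finset.range k, w i ≤ |casDet c x ξ| := by
  induction k with
  | zero => exact ⟨Fin.elim0, Fin.elim0, fun i => i.elim0, fun i => i.elim0, by simp [casDet]⟩
  | succ k ih =>
    obtain ⟨x, ξ, hx, hξ, h⟩ := ih (by omega)
    have hD : casDet c x ξ ≠ 0 := abs_pos.1 (lt_of_lt_of_le
      (Finset.prod_pos fun i hi => hw0 i (by have := Finset.mem_range.1 hi; omega)) h)
    have hex : ∃ a ∈ Set.Icc (-1 : ℝ) 1, ∃ b ∈ Set.Icc (-1 : ℝ) 1,
        w k * |casDet c x ξ| < |casDet c (Fin.cons a x) (Fin.cons b ξ)| := by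
      by_contra! hcon
      rcases hw k (by omega) with h1 | h1
      · exact absurd (le_of_abs_casDet_cons_le' hc hx hD hcon) (not_le.2 h1)
      · exact absurd (lambda_le_of_casDet_cons_le (by omega) hc hD hcon) (not_le.2 h1)
    obtain ⟨a, ha, b, hb, hab⟩ := hex
    refine ⟨Fin.cons a x, Fin.cons b ξ, Fin.cases (abs_le.2 ha) hx, Fin.cases (abs_le.2 hb) hξ, ?_⟩
    rw [Finset.prod_range_succ, mul_comm]
    exact (mul_le_mul_of_nonneg_left h (hw0 k (by omega)).le).trans hab.le

theorem log_le_of_le_pow {x σ : ℝ} (hx : 0 < x) (hσ : 0 < σ) (h : x ≤ (2 * σ) ^ 16) :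
    Real.log x ≤ 32 * σ := by
  calc Real.log x ≤ Real.log ((2 * σ) ^ 16) := Real.log_le_log hx h
    _ = 16 * Real.log (2 * σ) := by rw [Real.log_pow]; norm_num
    _ ≤ 16 * (2 * σ) := by
      gcongr
      exact (Real.log_le_sub_one_of_pos (by positivity)).trans (by linarith)
    _ = _ := by ring

theorem abs_casDet_le_exp_mul_prod {n : ℕ} {c M σ : ℝ} (hc : 0 ≤ c) (hσ : 1 ≤ σ)
    (hn : (n : ℝ) = σ ^ 16) (hcM : c ≤ M * σ ^ 8) {x ξ : Fin (n + 1) → ℝ}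
    (hx : ∀ i, |x i| ≤ 1) (hξ : ∀ i, |ξ i| ≤ 1) :
    |casDet c x ξ| ≤ Real.exp ((136 + 2 * M) * σ ^ 28) *
      ∏ k ∈ Finset.range (n + 1), (c / 4) ^ k / k.factorial := by
  have hσ0 : 0 < σ := by linarith
  set θ := 2 * Real.log σ with hθ
  have hθ0 : 0 ≤ θ := by have := Real.log_nonneg hσ; positivity
  have hexp : Real.exp θ = σ ^ 2 := by
    rw [hθ, ← Real.log_rpow hσ0, Real.exp_log (by positivity)]
    norm_num
  set y := c * Real.cosh θ ^ 2 with hy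
  have hN : ((n + 1 : ℕ) : ℝ) ≤ 2 * σ ^ 16 := by
    push_cast
    rw [hn]
    linarith [one_le_pow₀ hσ (n := 16)]
  have hy1 : y ≤ M * σ ^ 12 := by
    have h1 : Real.cosh θ ≤ σ ^ 2 := by
      rw [Real.cosh_eq, ← hexp]
      have : Real.exp (-θ) ≤ Real.exp θ := Real.exp_le_exp.2 (by linarith)
      linarith
    have h2 := Real.cosh_pos θ
    calc y ≤ M * σ ^ 8 * (σ ^ 2) ^ 2 := by
          refine mul_le_mul hcM ?_ (by positivity) (hc.trans hcM)
          gcongr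
      _ = _ := by ring
  have hterm : ∀ k ∈ Finset.range (n + 1), Real.exp (-(2 * θ * k)) * (y ^ k / k.factorial *
      Real.exp y) ≤ (c / 4) ^ k / k.factorial * Real.exp (2 * σ ^ 12 + M * σ ^ 12) := by
    intro k hk
    have hkn : (k : ℝ) ≤ σ ^ 16 := by
      rw [← hn]
      exact_mod_cast Nat.lt_succ_iff.1 (Finset.mem_range.1 hk)
    have h1 : Real.exp (-(2 * θ * k)) * y ^ k = (c / 4) ^ k * (1 + 1 / σ ^ 4) ^ (2 * k) := by
      have : Real.exp (-(2 * θ * k)) = (1 / σ ^ 4) ^ k := by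
        rw [show -(2 * θ * k) = k * (-(θ + θ)) by ring, Real.exp_nat_mul, Real.exp_neg,
          Real.exp_add, hexp]
        ring
      rw [this, hy, Real.cosh_eq, Real.exp_neg, hexp, pow_mul, ← mul_pow, ← mul_pow]
      congr 1
      field_simp
      norm_num
    have h2 : (1 + 1 / σ ^ 4) ^ (2 * k) ≤ Real.exp (2 * σ ^ 12) := by
      calc _ ≤ Real.exp (1 / σ ^ 4) ^ (2 * k) := by
            gcongr
            rw [add_comm]
            exact Real.add_one_le_exp _
        _ = Real.exp (2 * k / σ ^ 4) := by
            rw [← Real.exp_nat_mul]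
            push_cast
            ring_nf
        _ ≤ _ := by
            apply Real.exp_le_exp.2
            rw [div_le_iff₀ (by positivity)]
            nlinarith
    calc _ = Real.exp (-(2 * θ * k)) * y ^ k / k.factorial * Real.exp y := by ring
      _ = (c / 4) ^ k / k.factorial * ((1 + 1 / σ ^ 4) ^ (2 * k) * Real.exp y) := by
          rw [h1]
          ring
      _ ≤ (c / 4) ^ k / k.factorial * (Real.exp (2 * σ ^ 12) * Real.exp (M * σ ^ 12)) := by
          gcongr
      _ = _ := by rw [Real.exp_add]
  have hfac : (((n + 1).factorial : ℝ) * 2 ^ (n + 1)) ^ 2 ≤ Real.exp (128 * σ ^ 28) := by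
    have h1 : ((n + 1).factorial : ℝ) * 2 ^ (n + 1) ≤ (2 * (n + 1 : ℕ)) ^ (n + 1) := by
      rw [mul_pow, mul_comm]
      gcongr
      exact_mod_cast Nat.factorial_le_pow _
    have h2 : (2 * ((n + 1 : ℕ) : ℝ)) ≤ Real.exp (32 * σ) := by
      rw [← Real.log_le_iff_le_exp (by positivity)]
      refine log_le_of_le_pow (by positivity) hσ0 ?_
      rw [mul_pow]
      nlinarith [pow_pos hσ0 16]
    calc _ ≤ (Real.exp (32 * σ) ^ (n + 1)) ^ 2 := by
          gcongr
          exact h1.trans (by gcongr)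
      _ = Real.exp (2 * (n + 1 : ℕ) * (32 * σ)) := by
          rw [← pow_mul, ← Real.exp_nat_mul]
          push_cast
          ring_nf
      _ ≤ _ := by
          apply Real.exp_le_exp.2
          have h3 : σ ^ 17 ≤ σ ^ 28 := pow_le_pow_right₀ hσ (by norm_num)
          nlinarith
  refine (abs_casDet_le hc hθ0 hx hξ).trans ?_
  rw [mul_pow, Fin.prod_univ_eq_prod_range (fun k => y ^ k / (k.factorial : ℝ) * Real.exp y),
    mul_assoc]
  have h3 : Real.exp (-(θ * ((∑ k : Fin (n + 1), (k : ℕ) : ℕ) : ℝ))) ^ 2 =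
      ∏ k ∈ Finset.range (n + 1), Real.exp (-(2 * θ * k)) := by
    rw [Fin.sum_univ_eq_sum_range (fun k => k), ← Real.exp_sum, ← Real.exp_nat_mul]
    push_cast
    rw [Finset.sum_neg_distrib, ← Finset.mul_sum]
    ring_nf
  have h4 : ∏ k ∈ Finset.range (n + 1), (Real.exp (-(2 * θ * k)) * (y ^ k / k.factorial *
      Real.exp y)) ≤ (∏ k ∈ Finset.range (n + 1), (c / 4) ^ k / k.factorial) *
        Real.exp ((8 + 2 * M) * σ ^ 28) := by
    have hM : 0 ≤ M := by
      by_contra! hM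
      nlinarith [pow_pos hσ0 8]
    refine (Finset.prod_le_prod (fun k _ => by positivity) hterm).trans ?_
    rw [Finset.prod_mul_distrib, Finset.prod_const, Finset.card_range, ← Real.exp_nat_mul]
    refine mul_le_mul_of_nonneg_left (Real.exp_le_exp.2 ?_)
      (Finset.prod_nonneg fun k _ => by positivity)
    calc _ ≤ 2 * σ ^ 16 * (2 * σ ^ 12 + M * σ ^ 12) := by gcongr
      _ ≤ _ := by nlinarith [pow_pos hσ0 28]
  have h5 : Real.exp ((136 + 2 * M) * σ ^ 28) =
      Real.exp (128 * σ ^ 28) * Real.exp ((8 + 2 * M) * σ ^ 28) := by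
    rw [← Real.exp_add]
    ring_nf
  push_cast at h3 ⊢
  rw [h3, ← Finset.prod_mul_distrib, h5, mul_assoc, mul_comm (Real.exp ((8 + 2 * M) * σ ^ 28))]
  have : 0 ≤ ∏ k ∈ Finset.range (n + 1), (Real.exp (-(2 * θ * k)) * (y ^ k / k.factorial *
      Real.exp y)) := Finset.prod_nonneg fun k _ => by positivity
  gcongr

theorem exp_neg_le_exp_div {n k : ℕ} {c M σ : ℝ} (hc : 0 ≤ c) (hσ : 1 ≤ σ)
    (hn : (n : ℝ) = σ ^ 16) (hcM : c ≤ M * σ ^ 8) (hk : k ≤ n) :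
    Real.exp (-((36 + 6 * M) * σ ^ 12)) <
      Real.exp (-2 * c - 4 * Real.sqrt (c * k)) / (4 * (k + 1)) := by
  have hσ0 : 0 < σ := by linarith
  have hM : 0 ≤ M := by
    by_contra! hM
    nlinarith [pow_pos hσ0 8]
  have hkn : (k : ℝ) ≤ σ ^ 16 := by
    rw [← hn]
    exact_mod_cast hk
  have h16 := one_le_pow₀ hσ (n := 16)
  have h1 : Real.sqrt (c * k) ≤ (1 + M) * σ ^ 12 := by
    apply Real.sqrt_le_iff.2 ⟨by positivity, ?_⟩
    calc c * k ≤ M * σ ^ 8 * σ ^ 16 := by gcongr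
      _ = M * σ ^ 24 := by ring
      _ ≤ (1 + M) ^ 2 * σ ^ 24 := by
        gcongr
        nlinarith
      _ = _ := by ring
  have h2 : 4 * ((k : ℝ) + 1) < Real.exp (32 * σ) := by
    rw [← Real.log_lt_iff_lt_exp (by positivity)]
    refine lt_of_lt_of_le (Real.log_lt_log (by positivity)
      (by linarith : 4 * ((k : ℝ) + 1) < 4 * (k + 1) + 1))
      (log_le_of_le_pow (by positivity) hσ0 ?_)
    rw [mul_pow]
    nlinarith
  have h3 : σ ^ 8 ≤ σ ^ 12 := pow_le_pow_right₀ hσ (by norm_num)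
  have h4 : σ ≤ σ ^ 12 := le_self_pow₀ hσ (by norm_num)
  calc Real.exp (-((36 + 6 * M) * σ ^ 12))
      ≤ Real.exp (-2 * c - 4 * Real.sqrt (c * k) - 32 * σ) := by
        apply Real.exp_le_exp.2
        nlinarith [mul_le_mul_of_nonneg_left h3 hM]
    _ = Real.exp (-2 * c - 4 * Real.sqrt (c * k)) / Real.exp (32 * σ) := Real.exp_sub _ _
    _ < _ := div_lt_div_of_pos_left (Real.exp_pos _) (by positivity) h2

theorem pow_div_factorial_le_mul_pow {m c : ℝ} (hm : 0 < m) (hmc : m ≤ c) {n k h : ℕ}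
    (hkn : k ≤ n) (hnk : n ≤ k + h) :
    (c / 4) ^ k / k.factorial ≤ (c / 4) ^ n / n.factorial * (1 + 4 * n / m) ^ h := by
  have hc : 0 < c := hm.trans_le hmc
  obtain ⟨d, rfl⟩ := Nat.exists_eq_add_of_le hkn
  have h1 : ((k + d).factorial : ℝ) ≤ (k + d : ℕ) ^ d * k.factorial := by
    have h := Nat.factorial_mul_descFactorial (Nat.le_add_left d k)
    rw [Nat.add_sub_cancel] at h
    rw [← h, mul_comm]
    exact_mod_cast Nat.mul_le_mul_right _ (Nat.descFactorial_le_pow _ _)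
  have h2 : ((k + d : ℕ) : ℝ) ≤ c / 4 * (1 + 4 * (k + d : ℕ) / m) := by
    have : ((k + d : ℕ) : ℝ) ≤ c / 4 * (4 * (k + d : ℕ) / m) := by
      rw [div_mul_div_comm, le_div_iff₀ (by positivity)]
      nlinarith [Nat.cast_nonneg (α := ℝ) (k + d)]
    linarith
  have h3 : (1 : ℝ) ≤ 1 + 4 * (k + d : ℕ) / m := by
    have : 0 ≤ 4 * ((k + d : ℕ) : ℝ) / m := by positivity
    linarith
  rw [div_mul_eq_mul_div, div_le_div_iff₀ (by positivity) (by positivity)]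
  calc (c / 4) ^ k * ((k + d).factorial : ℝ)
      ≤ (c / 4) ^ k * ((c / 4 * (1 + 4 * (k + d : ℕ) / m)) ^ d * k.factorial) := by
        refine mul_le_mul_of_nonneg_left (h1.trans ?_) (by positivity)
        gcongr
    _ = (c / 4) ^ (k + d) * (1 + 4 * (k + d : ℕ) / m) ^ d * k.factorial := by
        rw [mul_pow, pow_add]
        ring
    _ ≤ _ := by
        gcongr
        omega

theorem le_exp_mul_of_lt_lambda {n : ℕ} {m c M σ η : ℝ} (hm : 0 < m) (hmc : m ≤ c) (hσ : 1 ≤ σ)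
    (hn : (n : ℝ) = σ ^ 16) (hcM : c ≤ M * σ ^ 8) (hη : 0 < η)
    (hlam : 2 * c / Real.pi * η ^ 2 < lambda n c) :
    η ≤ (c / 4) ^ n / n.factorial * Real.exp ((204 + 8 * M + 8 / m) * σ ^ 15) := by
  have hσ0 : 0 < σ := by linarith
  have hc : 0 < c := hm.trans_le hmc
  have hM : 0 ≤ M := by
    by_contra! hM
    nlinarith [pow_pos hσ0 8]
  set a : ℕ → ℝ := fun k => (c / 4) ^ k / k.factorial with ha
  have ha0 : ∀ k, 0 < a k := fun k => by positivity
  set δ := Real.exp (-((36 + 6 * M) * σ ^ 12)) with hδ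
  set h := ⌈σ ^ 14⌉₊ with hh
  have hh1 : σ ^ 14 ≤ h := Nat.le_ceil _
  have hh0 : 0 < h := Nat.ceil_pos.2 (by positivity)
  have hh2 : (h : ℝ) ≤ 2 * σ ^ 14 := by
    have := (Nat.ceil_lt_add_one (pow_pos hσ0 14).le).le
    linarith [one_le_pow₀ hσ (n := 14)]
  have hhn : h ≤ n := by
    apply Nat.ceil_le.2
    rw [hn]
    exact pow_le_pow_right₀ hσ (by norm_num)
  obtain ⟨p, hp1⟩ : ∃ p, n + 1 = p + h := ⟨n + 1 - h, by omega⟩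
  obtain ⟨x, ξ, hx, hξ, hlow⟩ := exists_prod_le_abs_casDet hc
    (w := fun k => if k < p then a k * δ else η) (n := n)
    (fun k _ => by
      split_ifs
      · exact mul_pos (ha0 k) (Real.exp_pos _)
      · exact hη)
    (fun k hk => by
      split_ifs
      · exact Or.inl (mul_lt_mul_of_pos_left (exp_neg_le_exp_div hc.le hσ hn hcM hk) (ha0 k))
      · exact Or.inr hlam) (n + 1) le_rfl
  have hup := hlow.trans (abs_casDet_le_exp_mul_prod hc.le hσ hn hcM hx hξ)
  rw [hp1, Finset.prod_range_add, Finset.prod_range_add] at hup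
  have e1 : ∏ k ∈ Finset.range (p), (if k < p then a k * δ else η) =
      (∏ k ∈ Finset.range (p), a k) * δ ^ (p) := by
    rw [Finset.prod_congr rfl fun k hk => if_pos (Finset.mem_range.1 hk), Finset.prod_mul_distrib]
    simp
  have e2 : ∏ k ∈ Finset.range h, (if p + k < p then a (p + k) * δ else η) =
      η ^ h := by
    simp
  rw [e1, e2] at hup
  set Q := ∏ k ∈ Finset.range (p), a k with hQ
  have hQ0 : 0 < Q := Finset.prod_pos fun k _ => ha0 k
  set r := 1 + 4 * (n : ℝ) / m with hr
  have hr0 : 1 ≤ r := by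
    have : 0 ≤ 4 * (n : ℝ) / m := by positivity
    linarith
  have e3 : ∏ k ∈ Finset.range h, a (p + k) ≤ (a n * r ^ h) ^ h := by
    refine (Finset.prod_le_prod (fun k _ => (ha0 _).le) (g := fun _ => a n * r ^ h)
      fun k hk => ?_).trans (by simp)
    have := Finset.mem_range.1 hk
    exact pow_div_factorial_le_mul_pow hm hmc (by omega) (by omega)
  have hδh : Real.exp (-((36 + 6 * M) * σ ^ 28)) ≤ δ ^ (p) := by
    rw [hδ, ← Real.exp_nat_mul]
    apply Real.exp_le_exp.2
    have : (p : ℝ) ≤ σ ^ 16 := by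
      rw [← hn]
      exact_mod_cast (by omega : p ≤ n)
    have h2 : 0 ≤ (36 + 6 * M) * σ ^ 12 := by positivity
    nlinarith
  have e4 : η ^ h ≤ Real.exp ((172 + 8 * M) * σ ^ 28) * (a n * r ^ h) ^ h := by
    have h1 : Q * Real.exp (-((36 + 6 * M) * σ ^ 28)) * η ^ h ≤
        Real.exp ((136 + 2 * M) * σ ^ 28) * (Q * (a n * r ^ h) ^ h) :=
      calc _ ≤ Q * δ ^ (p) * η ^ h := by gcongr
        _ ≤ _ := hup
        _ ≤ _ := by gcongr
    have h2 : Real.exp ((172 + 8 * M) * σ ^ 28) =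
        Real.exp ((136 + 2 * M) * σ ^ 28) / Real.exp (-((36 + 6 * M) * σ ^ 28)) := by
      rw [← Real.exp_sub]
      ring_nf
    rw [h2, div_mul_eq_mul_div, le_div_iff₀ (Real.exp_pos _)]
    refine le_of_mul_le_mul_left ?_ hQ0
    linarith
  have e5 : η ^ h ≤ (Real.exp ((172 + 8 * M) * σ ^ 14) * (a n * r ^ h)) ^ h := by
    rw [mul_pow, ← Real.exp_nat_mul]
    refine e4.trans (mul_le_mul_of_nonneg_right (Real.exp_le_exp.2 ?_) (by positivity))
    have : 0 ≤ (172 + 8 * M) * σ ^ 14 := by positivity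
    calc _ = σ ^ 14 * ((172 + 8 * M) * σ ^ 14) := by ring
      _ ≤ _ := by gcongr
  have e6 : r ^ h ≤ Real.exp ((32 + 8 / m) * σ ^ 15) := by
    have h1 : r ≤ Real.exp ((16 + 4 / m) * σ) := by
      have h2 : r ≤ (1 + 4 / m) * σ ^ 16 := by
        rw [hr, hn]
        have := one_le_pow₀ hσ (n := 16)
        calc _ ≤ σ ^ 16 + 4 * σ ^ 16 / m := by linarith
          _ = _ := by ring
      have h3 : 1 + 4 / m ≤ Real.exp (4 / m * σ) := by
        rw [add_comm]
        refine (Real.add_one_le_exp _).trans (Real.exp_le_exp.2 ?_)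
        exact le_mul_of_one_le_right (by positivity) hσ
      have h4 : σ ^ 16 ≤ Real.exp (16 * σ) := by
        calc σ ^ 16 ≤ Real.exp σ ^ 16 := by
              gcongr
              linarith [Real.add_one_le_exp σ]
          _ = _ := by rw [← Real.exp_nat_mul]; norm_num
      calc r ≤ _ := h2
        _ ≤ Real.exp (4 / m * σ) * Real.exp (16 * σ) := by gcongr
        _ = _ := by rw [← Real.exp_add]; ring_nf
    calc r ^ h ≤ Real.exp ((16 + 4 / m) * σ) ^ h := by gcongr
      _ = Real.exp (h * ((16 + 4 / m) * σ)) := (Real.exp_nat_mul _ _).symm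
      _ ≤ Real.exp (2 * σ ^ 14 * ((16 + 4 / m) * σ)) := by gcongr
      _ = _ := by ring_nf
  refine (pow_le_pow_iff_left₀ hη.le (by positivity) hh0.ne').1 e5 |>.trans ?_
  calc _ = a n * (Real.exp ((172 + 8 * M) * σ ^ 14) * r ^ h) := by ring
    _ ≤ a n * (Real.exp ((172 + 8 * M) * σ ^ 15) * Real.exp ((32 + 8 / m) * σ ^ 15)) := by
        have := (ha0 n).le
        gcongr
        norm_num
    _ = _ := by
        rw [← Real.exp_add, ha]
        ring_nf

theorem stmt1 (m M ε : ℝ) (hm : 0 < m) (hmM : m < M) (hε : 0 < ε) :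
    ∃ A : ℝ, 0 < A ∧ ∀ n : ℕ, 1 ≤ n → ∀ c : ℝ, m ≤ c → c ≤ M * Real.sqrt n →
      lambda n c ≤ A * Real.exp (ε * n) *
        (Real.exp 1 * c / (4 * ((n:ℝ) + 1/2)))^(2*n+1) := by
  set C := 204 + 8 * M + 8 / m with hC
  have hM : 0 < M := hm.trans hmM
  have hC0 : 0 < C := by positivity
  set K := 2 * C + 16 with hK
  refine ⟨32 * Real.exp (K * (K / ε) ^ 15), by positivity, fun n hn1 c hmc hcM => ?_⟩
  have hc : 0 < c := hm.trans_le hmc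
  have hn1' : (1 : ℝ) ≤ n := by exact_mod_cast hn1
  rcases le_or_gt (lambda n c) 0 with h0 | h0
  · exact h0.trans (by positivity)
  obtain ⟨σ, hσ, hn⟩ : ∃ σ : ℝ, 1 ≤ σ ∧ (n : ℝ) = σ ^ 16 := by
    refine ⟨(n : ℝ) ^ (1 / 16 : ℝ), Real.one_le_rpow hn1' (by norm_num), ?_⟩
    rw [← Real.rpow_natCast, ← Real.rpow_mul (by positivity)]
    norm_num
  have hσ0 : 0 < σ := by linarith
  have hsqrt : Real.sqrt n = σ ^ 8 := by
    rw [hn, show σ ^ 16 = (σ ^ 8) ^ 2 by ring, Real.sqrt_sq (by positivity)]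
  rw [hsqrt] at hcM
  set η := Real.sqrt (lambda n c * Real.pi / (4 * c)) with hη
  have hπ := Real.pi_pos
  have hη0 : 0 < η := Real.sqrt_pos.2 (by positivity)
  have hηsq : η ^ 2 = lambda n c * Real.pi / (4 * c) := Real.sq_sqrt (by positivity)
  have hηle := le_exp_mul_of_lt_lambda hm hmc hσ hn hcM hη0 (by
    rw [hηsq]
    field_simp
    linarith)
  rw [← hC] at hηle
  have hlam : lambda n c = 4 * c / Real.pi * η ^ 2 := by
    rw [hηsq]
    field_simp
  have hst : ((n : ℝ) + 1 / 2) ^ n / n.factorial ≤ Real.exp (n + 1 / 2) :=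
    Real.pow_div_factorial_le_exp _ (by positivity) n
  set p := (n : ℝ) + 1 / 2 with hp
  have hp0 : 0 < p := by positivity
  have hpσ : 2 * p ≤ 4 * Real.exp (16 * σ ^ 15) := by
    have h1 : σ ^ 16 ≤ Real.exp (16 * σ) := by
      calc σ ^ 16 ≤ Real.exp σ ^ 16 := by
            gcongr
            linarith [Real.add_one_le_exp σ]
        _ = _ := by rw [← Real.exp_nat_mul]; norm_num
    have h2 : Real.exp (16 * σ) ≤ Real.exp (16 * σ ^ 15) := by
      gcongr
      exact le_self_pow₀ hσ (by norm_num)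
    rw [hp]
    linarith
  have hKε : Real.exp (K * σ ^ 15) ≤ Real.exp (K * (K / ε) ^ 15) * Real.exp (ε * n) := by
    rw [← Real.exp_add]
    apply Real.exp_le_exp.2
    rw [hn]
    have hK0 : 0 < K := by positivity
    rcases le_total σ (K / ε) with h | h
    · have : K * σ ^ 15 ≤ K * (K / ε) ^ 15 := by gcongr
      have : 0 ≤ ε * σ ^ 16 := by positivity
      linarith
    · have h1 : K ≤ ε * σ := by rwa [div_le_iff₀' hε] at h
      have : K * σ ^ 15 ≤ ε * σ * σ ^ 15 := by gcongr
      have : 0 ≤ K * (K / ε) ^ 15 := by positivity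
      linarith
  have hexp : Real.exp p ^ 2 = Real.exp 1 ^ (2 * n + 1) := by
    rw [← Real.exp_nat_mul, ← Real.exp_nat_mul, hp]
    push_cast
    ring_nf
  have hstsq : p ^ (2 * n) / (n.factorial : ℝ) ^ 2 ≤ Real.exp 1 ^ (2 * n + 1) := by
    rw [← hexp]
    calc _ = (p ^ n / n.factorial) ^ 2 := by rw [div_pow, ← pow_mul, mul_comm n]
      _ ≤ _ := by gcongr
  calc lambda n c = 4 * c / Real.pi * η ^ 2 := hlam
    _ ≤ 4 * c / Real.pi * ((c / 4) ^ n / n.factorial * Real.exp (C * σ ^ 15)) ^ 2 := by gcongr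
    _ = 16 / Real.pi * p * Real.exp (C * σ ^ 15) ^ 2 * (p ^ (2 * n) / (n.factorial : ℝ) ^ 2) *
        (c / (4 * p)) ^ (2 * n + 1) := by
      rw [div_pow, div_pow, mul_pow]
      field_simp
      ring_nf
    _ ≤ 4 * (2 * p) * Real.exp (C * σ ^ 15) ^ 2 * Real.exp 1 ^ (2 * n + 1) *
        (c / (4 * p)) ^ (2 * n + 1) := by
      have : 16 / Real.pi * p ≤ 4 * (2 * p) := by
        rw [div_mul_eq_mul_div, div_le_iff₀ hπ]
        nlinarith [Real.pi_gt_three]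
      gcongr
    _ ≤ 4 * (4 * Real.exp (16 * σ ^ 15)) * Real.exp (C * σ ^ 15) ^ 2 * Real.exp 1 ^ (2 * n + 1) *
        (c / (4 * p)) ^ (2 * n + 1) := by gcongr
    _ = 16 * Real.exp (K * σ ^ 15) * (Real.exp 1 * c / (4 * p)) ^ (2 * n + 1) := by
      rw [mul_div_assoc, mul_pow (Real.exp 1), ← Real.exp_nat_mul, hK,
        show (2 * C + 16) * σ ^ 15 = 16 * σ ^ 15 + (2 : ℕ) * (C * σ ^ 15) by push_cast; ring,
        Real.exp_add]
      ring
    _ ≤ 32 * (Real.exp (K * (K / ε) ^ 15) * Real.exp (ε * n)) *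
        (Real.exp 1 * c / (4 * p)) ^ (2 * n + 1) := by
      gcongr
      norm_num
    _ = _ := by ring
end

section
/- There exist constants a > 0 and δ ≥ 1 such that for every real c ≥ 1 and every integer n with n > 1.35·c, one has λ_n(c) ≤ δ · e^{−a·n}. -/
open MeasureTheory

/-- Moving the contour to the circle of radius `R` bounds the Laurent coefficients
of `w ↦ h ((w + w⁻¹) / 2)`. -/
theorem norm_circleIntegral_joukowski_le {h : ℂ → ℂ} {M : ℝ} (hd : Differentiable ℂ h)
    (hM : ∀ z : ℂ, |z.im| ≤ 3 / 4 → ‖h z‖ ≤ M) (k : ℤ) {R : ℝ} (hR : R = 2 ∨ R = 1 / 2) :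
    ‖∮ w in C(0, 1), h ((w + w⁻¹) / 2) * w ^ (-k - 1)‖ ≤ 2 * Real.pi * (M * R ^ (-k)) := by
  have hR0 : 0 < R := by rcases hR with rfl | rfl <;> norm_num
  have hdiff : ∀ z : ℂ, z ≠ 0 →
      DifferentiableAt ℂ (fun w : ℂ => h ((w + w⁻¹) / 2) * w ^ (-k - 1)) z := by
    intro z hz
    refine DifferentiableAt.mul ?_ (differentiableAt_zpow.2 (Or.inl hz))
    exact (hd _).comp z ((differentiableAt_id.add (differentiableAt_inv hz)).div_const 2)
  have key : ∀ r s : ℝ, 0 < r → r ≤ s →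
      (∮ w in C(0, s), h ((w + w⁻¹) / 2) * w ^ (-k - 1)) =
        ∮ w in C(0, r), h ((w + w⁻¹) / 2) * w ^ (-k - 1) := by
    intro r s hr hrs
    refine Complex.circleIntegral_eq_of_differentiable_on_annulus_off_countable hr hrs
      Set.countable_empty ?_ ?_
    · intro z hz
      refine (hdiff z ?_).continuousAt.continuousWithinAt
      rintro rfl
      exact hz.2 (by simpa using hr)
    · intro z hz
      refine hdiff z ?_
      rintro rfl
      exact hz.1.2 (by simpa using hr.le)
  have hmove : (∮ w in C(0, 1), h ((w + w⁻¹) / 2) * w ^ (-k - 1)) =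
      ∮ w in C(0, R), h ((w + w⁻¹) / 2) * w ^ (-k - 1) := by
    rcases hR with rfl | rfl
    · exact (key 1 2 one_pos (by norm_num)).symm
    · exact key (1 / 2) 1 (by norm_num) (by norm_num)
  rw [hmove]
  have hb : ∀ z ∈ Metric.sphere (0 : ℂ) R, ‖h ((z + z⁻¹) / 2) * z ^ (-k - 1)‖ ≤
      M * R ^ (-k - 1) := by
    intro z hz
    have hzR : ‖z‖ = R := by simpa using hz
    rw [norm_mul, norm_zpow, hzR]
    refine mul_le_mul_of_nonneg_right (hM _ ?_) (by positivity)
    have him : ((z + z⁻¹) / 2).im = z.im * (1 - (R ^ 2)⁻¹) / 2 := by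
      have : ((z + z⁻¹) / 2).im = (z + z⁻¹).im / 2 := by
        simp
      rw [this, Complex.add_im, Complex.inv_im, Complex.normSq_eq_norm_sq, hzR]
      ring
    have hzi : |z.im| ≤ R := hzR ▸ Complex.abs_im_le_norm z
    rw [him, abs_div, abs_mul]
    rcases hR with rfl | rfl <;> norm_num [abs_of_pos, abs_of_neg] <;> linarith
  refine (circleIntegral.norm_integral_le_of_norm_le_const hR0.le hb).trans_eq ?_
  rw [zpow_sub_one₀ hR0.ne']
  field_simp

/-- An entire function bounded by `M` on the strip `|Im z| ≤ 3 / 4` is approximated on `[-1, 1]`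
with error `4 M 2⁻ⁿ` by combinations of the first `n` Chebyshev polynomials. -/
theorem exists_chebyshev_approx {h : ℂ → ℂ} {M : ℝ} (hd : Differentiable ℂ h)
    (hM : ∀ z : ℂ, |z.im| ≤ 3 / 4 → ‖h z‖ ≤ M) {n : ℕ} (hn : 1 ≤ n) :
    ∃ β : ℕ → ℝ, ∀ θ : ℝ,
      |(h (Real.cos θ : ℂ)).re - ∑ k ∈ Finset.range n, β k * Real.cos (k * θ)| ≤
        4 * M * (1 / 2) ^ n := by
  have : Fact (0 < 2 * Real.pi) := ⟨Real.two_pi_pos⟩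
  let g : C(AddCircle (2 * Real.pi), ℂ) :=
    ⟨fun t => h (((AddCircle.toCircle t : ℂ) + (AddCircle.toCircle t : ℂ)⁻¹) / 2), by
      refine hd.continuous.comp ?_
      have hc : Continuous fun t : AddCircle (2 * Real.pi) => (AddCircle.toCircle t : ℂ) :=
        continuous_subtype_val.comp AddCircle.continuous_toCircle
      exact (hc.add (hc.inv₀ fun t => Circle.coe_ne_zero _)).div_const 2⟩
  have hexp : ∀ θ : ℝ, ((AddCircle.toCircle (θ : AddCircle (2 * Real.pi)) : Circle) : ℂ) =
      Complex.exp (θ * Complex.I) := by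
    intro θ
    rw [AddCircle.toCircle_apply_mk, Circle.coe_exp]
    congr 2
    push_cast
    field_simp
  have hg : ∀ θ : ℝ, g (θ : AddCircle (2 * Real.pi)) = h (Real.cos θ : ℂ) := by
    intro θ
    change h _ = _
    rw [hexp, ← Complex.exp_neg, Complex.ofReal_cos, Complex.cos, neg_mul]
  have hcoef : ∀ k : ℤ, fourierCoeff g k = (1 / (2 * Real.pi * Complex.I)) *
      ∮ w in C(0, 1), h ((w + w⁻¹) / 2) * w ^ (-k - 1) := by
    intro k
    rw [fourierCoeff_eq_intervalIntegral g k 0, circleIntegral, zero_add,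
      ← intervalIntegral.integral_const_mul, ← intervalIntegral.integral_smul]
    congr 1
    ext θ
    have hw : circleMap 0 1 θ = Complex.exp (θ * Complex.I) := by simp [circleMap]
    have hf : (fourier (-k) (θ : AddCircle (2 * Real.pi)) : ℂ) =
        Complex.exp (θ * Complex.I) ^ (-k) := by
      rw [fourier_apply, AddCircle.toCircle_zsmul, Circle.coe_zpow, hexp]
    rw [hf, deriv_circleMap, hw, zpow_sub_one₀ (Complex.exp_ne_zero _)]
    change _ • (_ • h _) = _
    rw [hexp]
    have := Complex.exp_ne_zero (θ * Complex.I)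
    simp only [smul_eq_mul, Complex.real_smul]
    push_cast
    have hpi : (Real.pi : ℂ) ≠ 0 := by exact_mod_cast Real.pi_ne_zero
    field_simp
  have hcb : ∀ (k : ℤ) (R : ℝ), (R = 2 ∨ R = 1 / 2) → ‖fourierCoeff g k‖ ≤ M * R ^ (-k) := by
    intro k R hR
    have := norm_circleIntegral_joukowski_le hd hM k hR
    rw [hcoef, norm_mul]
    have h2 : ‖(1 / (2 * Real.pi * Complex.I) : ℂ)‖ = 1 / (2 * Real.pi) := by
      simp [abs_of_pos Real.pi_pos]
    rw [h2, one_div, inv_mul_le_iff₀ Real.two_pi_pos]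
    exact this
  have hpos : ∀ k : ℕ, ‖fourierCoeff g (k : ℤ)‖ ≤ M * (1 / 2) ^ k := by
    intro k
    refine (hcb k 2 (Or.inl rfl)).trans_eq ?_
    simp
  have hneg : ∀ k : ℕ, ‖fourierCoeff g (-(k : ℤ))‖ ≤ M * (1 / 2) ^ k := by
    intro k
    refine (hcb _ (1 / 2) (Or.inr rfl)).trans_eq ?_
    simp
  have hgeo : Summable fun k : ℕ => M * (1 / 2 : ℝ) ^ k :=
    (summable_geometric_of_lt_one (by norm_num) (by norm_num)).mul_left M
  have hsum : Summable (fourierCoeff g) :=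
    Summable.of_nat_of_neg (Summable.of_norm_bounded hgeo hpos)
      (Summable.of_norm_bounded hgeo hneg)
  refine ⟨fun k => (fourierCoeff g (k : ℤ) + fourierCoeff g (-(k : ℤ))).re -
    if k = 0 then (fourierCoeff g 0).re else 0, fun θ => ?_⟩
  have hser : ∀ φ : ℝ, HasSum (fun k : ℤ => fourierCoeff g k *
      Complex.exp (φ * Complex.I) ^ k) (h (Real.cos φ : ℂ)) := by
    intro φ
    have := has_pointwise_sum_fourier_series_of_summable hsum (φ : AddCircle (2 * Real.pi))
    rw [hg] at this
    refine this.congr_fun ?_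
    intro k
    rw [fourier_apply, AddCircle.toCircle_zsmul, Circle.coe_zpow, hexp, smul_eq_mul]
  have hcos : HasSum (fun k : ℤ => fourierCoeff g k * (Real.cos (k * θ) : ℂ))
      (h (Real.cos θ : ℂ)) := by
    have h2 := ((hser θ).add (hser (-θ))).div_const 2
    rw [Real.cos_neg, add_self_div_two] at h2
    refine h2.congr_fun ?_
    intro k
    rw [← mul_add, mul_div_assoc, ← Complex.exp_int_mul, ← Complex.exp_int_mul,
      Complex.ofReal_cos, Complex.cos]
    push_cast
    congr 4 <;> ring
  have hnat := hcos.nat_add_neg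
  have hbound : ∀ k : ℕ, ‖fourierCoeff g (k : ℤ) * (Real.cos ((k : ℤ) * θ) : ℂ) +
      fourierCoeff g (-(k : ℤ)) * (Real.cos ((-(k : ℤ) : ℤ) * θ) : ℂ)‖ ≤
        2 * M * (1 / 2) ^ k := by
    intro k
    have hc : ∀ x : ℝ, ‖(Real.cos x : ℂ)‖ ≤ 1 := fun x => by
      rw [Complex.norm_real]; exact Real.abs_cos_le_one x
    calc _ ≤ ‖fourierCoeff g (k : ℤ)‖ * 1 + ‖fourierCoeff g (-(k : ℤ))‖ * 1 := by
          refine (norm_add_le _ _).trans ?_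
          rw [norm_mul, norm_mul]
          gcongr <;> exact hc _
      _ ≤ _ := by linarith [hpos k, hneg k]
  have herr := norm_sub_le_of_geometric_bound_of_hasSum (by norm_num) hbound hnat n
  have hre := (Complex.abs_re_le_norm _).trans herr
  have hfin : (∑ k ∈ Finset.range n, ((fourierCoeff g (k : ℤ) + fourierCoeff g (-(k : ℤ))).re -
      if k = 0 then (fourierCoeff g 0).re else 0) * Real.cos (k * θ)) =
      (∑ k ∈ Finset.range n, (fourierCoeff g (k : ℤ) * (Real.cos ((k : ℤ) * θ) : ℂ) +
      fourierCoeff g (-(k : ℤ)) * (Real.cos ((-(k : ℤ) : ℤ) * θ) : ℂ))).re -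
        (fourierCoeff g 0).re := by
    have h0 : (fourierCoeff g 0).re = ∑ k ∈ Finset.range n,
        (if k = 0 then (fourierCoeff g 0).re else 0) * Real.cos (k * θ) := by
      rw [Finset.sum_eq_single 0]
      · simp
      · intro b _ hb
        simp [hb]
      · intro hb
        exact absurd (Finset.mem_range.2 hn) hb
    conv_rhs => rw [h0]
    rw [Complex.re_sum, ← Finset.sum_sub_distrib]
    refine Finset.sum_congr rfl fun k _ => ?_
    have hk : Real.cos ((-(k : ℤ) : ℤ) * θ) = Real.cos (k * θ) := by
      push_cast
      rw [neg_mul, Real.cos_neg]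
    rw [hk, Int.cast_natCast, ← add_mul, Complex.re_mul_ofReal]
    ring
  rw [hfin, abs_sub_comm]
  rw [Complex.sub_re, Complex.add_re] at hre
  have h0 : (fourierCoeff g 0 * (Real.cos ((0 : ℤ) * θ) : ℂ)).re = (fourierCoeff g 0).re := by
    simp
  rw [h0] at hre
  calc _ = _ := by congr 1; ring
    _ ≤ _ := hre
    _ = _ := by ring

theorem norm_cos_le_exp_abs_im (z : ℂ) : ‖Complex.cos z‖ ≤ Real.exp |z.im| := by
  have h1 : ‖Complex.exp (z * Complex.I)‖ ≤ Real.exp |z.im| := by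
    rw [Complex.norm_exp]
    exact Real.exp_le_exp.2 (by simpa using neg_le_abs z.im)
  have h2 : ‖Complex.exp (-z * Complex.I)‖ ≤ Real.exp |z.im| := by
    rw [Complex.norm_exp]
    exact Real.exp_le_exp.2 (by simpa using le_abs_self z.im)
  rw [Complex.cos, norm_div, Complex.norm_two, div_le_iff₀ two_pos]
  linarith [norm_add_le (Complex.exp (z * Complex.I)) (Complex.exp (-z * Complex.I))]

theorem norm_dslope_sin_le (u : ℂ) : ‖dslope Complex.sin 0 u‖ ≤ Real.exp |u.im| := by
  rcases eq_or_ne u 0 with rfl | hu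
  · simp
  · rw [dslope_of_ne _ hu, slope_def_field, norm_div, sub_zero,
      div_le_iff₀ (norm_pos_iff.2 hu)]
    have hconv : Convex ℝ {z : ℂ | |z.im| ≤ |u.im|} := by
      have : {z : ℂ | |z.im| ≤ |u.im|} = Complex.imLm ⁻¹' Set.Icc (-|u.im|) |u.im| := by
        ext z
        simp [abs_le]
      rw [this]
      exact (convex_Icc _ _).linear_preimage _
    have h := hconv.norm_image_sub_le_of_norm_deriv_le (f := Complex.sin) (x := 0) (y := u)
      (C := Real.exp |u.im|) (fun z _ => Complex.differentiable_sin z)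
      (fun z hz => by
        rw [Complex.deriv_sin]
        exact (norm_cos_le_exp_abs_im z).trans (Real.exp_le_exp.2 hz)) (by simp) (by simp)
    simpa using h

theorem differentiable_dslope_sin : Differentiable ℂ (dslope Complex.sin 0) :=
  differentiableOn_univ.1
    ((Complex.differentiableOn_dslope Filter.univ_mem).2
      Complex.differentiable_sin.differentiableOn)

theorem sincKernel_eq_re {c : ℝ} (hc : 0 < c) (x y : ℝ) :
    sincKernel c x y =
      (((c / Real.pi : ℝ) : ℂ) * dslope Complex.sin 0 ((c : ℂ) * ((x : ℂ) - (y : ℂ)))).re := by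
  rw [Complex.re_ofReal_mul, sincKernel]
  split_ifs with hxy
  · simp [hxy]
  · have h1 : c * (x - y) ≠ 0 := mul_ne_zero hc.ne' (sub_ne_zero.2 hxy)
    have h2 : (c : ℂ) * ((x : ℂ) - (y : ℂ)) = ((c * (x - y) : ℝ) : ℂ) := by push_cast; rfl
    rw [h2, dslope_of_ne _ (by exact_mod_cast h1), slope_def_field, Complex.sin_zero, sub_zero,
      sub_zero, ← Complex.ofReal_sin, ← Complex.ofReal_div, Complex.ofReal_re]
    have h3 := sub_ne_zero.2 hxy
    field_simp

theorem exists_sincKernel_approx {c : ℝ} (hc : 0 < c) {n : ℕ} (hn : 1 ≤ n) (x : ℝ) :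
    ∃ β : ℕ → ℝ, ∀ y ∈ Set.Ioo (-1 : ℝ) 1,
      |sincKernel c x y - ∑ k ∈ Finset.range n, β k * Real.cos (k * Real.arccos y)| ≤
        4 * (c / Real.pi * Real.exp (3 / 4 * c)) * (1 / 2) ^ n := by
  have hcpi : 0 < c / Real.pi := div_pos hc Real.pi_pos
  obtain ⟨β, hβ⟩ := exists_chebyshev_approx
    (h := fun z => ((c / Real.pi : ℝ) : ℂ) * dslope Complex.sin 0 ((c : ℂ) * ((x : ℂ) - z)))
    (M := c / Real.pi * Real.exp (3 / 4 * c))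
    ((differentiable_dslope_sin.comp ((differentiable_id.const_sub _).const_mul _)).const_mul _)
    (fun z hz => by
      rw [norm_mul, Complex.norm_real, Real.norm_of_nonneg hcpi.le]
      refine mul_le_mul_of_nonneg_left ((norm_dslope_sin_le _).trans ?_) hcpi.le
      refine Real.exp_le_exp.2 ?_
      rw [Complex.im_ofReal_mul, Complex.sub_im, Complex.ofReal_im, zero_sub, abs_mul, abs_neg,
        abs_of_pos hc]
      nlinarith) hn
  refine ⟨β, fun y hy => ?_⟩
  have := hβ (Real.arccos y)
  rw [Real.cos_arccos hy.1.le hy.2.le] at this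
  rw [sincKernel_eq_re hc]
  exact this

theorem integrable_of_Lp_Ioo (f : Lp ℝ 2 (volume.restrict (Set.Ioo (-1 : ℝ) 1))) :
    Integrable f (volume.restrict (Set.Ioo (-1 : ℝ) 1)) :=
  (Lp.memLp f).integrable one_le_two

theorem integrable_cos_arccos_mul (k : ℕ)
    (f : Lp ℝ 2 (volume.restrict (Set.Ioo (-1 : ℝ) 1))) :
    Integrable (fun y => Real.cos (k * Real.arccos y) * f y)
      (volume.restrict (Set.Ioo (-1 : ℝ) 1)) := by
  refine (integrable_of_Lp_Ioo f).bdd_mul (c := 1)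
    (by fun_prop : Continuous fun y => Real.cos (k * Real.arccos y)).aestronglyMeasurable
    (Filter.Eventually.of_forall fun y => Real.abs_cos_le_one _)

theorem sq_integral_abs_le (f : Lp ℝ 2 (volume.restrict (Set.Ioo (-1 : ℝ) 1))) :
    (∫ y in Set.Ioo (-1 : ℝ) 1, |f y|) ^ 2 ≤ 2 * ‖f‖ ^ 2 := by
  set A := ∫ y in Set.Ioo (-1 : ℝ) 1, |f y| with hA
  have hint := (integrable_of_Lp_Ioo f).abs
  have hsq : Integrable (fun y => f y ^ 2) (volume.restrict (Set.Ioo (-1 : ℝ) 1)) :=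
    (Lp.memLp f).integrable_sq
  have hnorm : ‖f‖ ^ 2 = ∫ y in Set.Ioo (-1 : ℝ) 1, f y ^ 2 := by
    rw [← real_inner_self_eq_norm_sq, L2.inner_def]
    simp [sq]
  have h0 : 0 ≤ ∫ y in Set.Ioo (-1 : ℝ) 1, (f y ^ 2 - A * |f y| + A ^ 2 / 4) :=
    integral_nonneg fun y => by
      have := sq_nonneg (|f y| - A / 2)
      rw [sub_sq, sq_abs] at this
      change 0 ≤ f y ^ 2 - A * |f y| + A ^ 2 / 4
      linarith
  have hsub : Integrable (fun y => f y ^ 2 - A * |f y|)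
      (volume.restrict (Set.Ioo (-1 : ℝ) 1)) := hsq.sub (hint.const_mul A)
  rw [integral_add hsub (integrable_const _),
    integral_sub hsq (hint.const_mul A), integral_const_mul, ← hA, ← hnorm] at h0
  simp only [integral_const, smul_eq_mul, measureReal_restrict_apply_univ, Real.volume_real_Ioo]
    at h0
  norm_num at h0
  linarith

/-- If the kernel is `ε`-close to the span of the first `n` Chebyshev polynomials in `y`, then the
quadratic form is small on functions orthogonal to these polynomials. -/
theorem QForm_le_of_orthogonal {c ε : ℝ} {n : ℕ}
    (happ : ∀ x : ℝ, ∃ β : ℕ → ℝ, ∀ y ∈ Set.Ioo (-1 : ℝ) 1,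
      |sincKernel c x y - ∑ k ∈ Finset.range n, β k * Real.cos (k * Real.arccos y)| ≤ ε)
    (hε : 0 ≤ ε) (f : Lp ℝ 2 (volume.restrict (Set.Ioo (-1 : ℝ) 1)))
    (hf : ∀ k < n, ∫ y in Set.Ioo (-1 : ℝ) 1, Real.cos (k * Real.arccos y) * f y = 0) :
    QForm c f ≤ 2 * ε * ‖f‖ ^ 2 := by
  have hint := (integrable_of_Lp_Ioo f).abs
  set A := ∫ y in Set.Ioo (-1 : ℝ) 1, |f y| with hA
  have hA0 : 0 ≤ A := integral_nonneg fun _ => abs_nonneg _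
  have hinner : ∀ x : ℝ, |∫ y in Set.Ioo (-1 : ℝ) 1, sincKernel c x y * f y| ≤ ε * A := by
    intro x
    by_cases hK : Integrable (fun y => sincKernel c x y * f y)
        (volume.restrict (Set.Ioo (-1 : ℝ) 1))
    · obtain ⟨β, hβ⟩ := happ x
      have hterm : ∀ k ∈ Finset.range n, Integrable
          (fun y => β k * (Real.cos (k * Real.arccos y) * f y))
          (volume.restrict (Set.Ioo (-1 : ℝ) 1)) := fun k _ =>
        (integrable_cos_arccos_mul k f).const_mul _
      have hzero : ∫ y in Set.Ioo (-1 : ℝ) 1,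
          ∑ k ∈ Finset.range n, β k * (Real.cos (k * Real.arccos y) * f y) = 0 := by
        rw [integral_finsetSum _ hterm]
        refine Finset.sum_eq_zero fun k hk => ?_
        rw [integral_const_mul, hf k (Finset.mem_range.1 hk), mul_zero]
      rw [← sub_zero (∫ y in Set.Ioo (-1 : ℝ) 1, sincKernel c x y * f y), ← hzero,
        ← integral_sub hK (integrable_finsetSum _ hterm), hA, ← integral_const_mul,
        ← Real.norm_eq_abs]
      refine norm_integral_le_of_norm_le (hint.const_mul ε) ?_
      refine (ae_restrict_iff' measurableSet_Ioo).2 (Filter.Eventually.of_forall fun y hy => ?_)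
      rw [Real.norm_eq_abs]
      simp_rw [← mul_assoc]
      rw [← Finset.sum_mul, ← sub_mul, abs_mul]
      exact mul_le_mul_of_nonneg_right (hβ y hy) (abs_nonneg _)
    · rw [integral_undef hK, abs_zero]
      positivity
  have hQ : |QForm c f| ≤ ∫ x in Set.Ioo (-1 : ℝ) 1, ε * A * |f x| := by
    rw [← Real.norm_eq_abs, QForm]
    refine norm_integral_le_of_norm_le (hint.const_mul _)
      (Filter.Eventually.of_forall fun x => ?_)
    rw [integral_mul_const, norm_mul]
    exact mul_le_mul_of_nonneg_right (hinner x) (abs_nonneg _)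
  rw [integral_const_mul, ← hA] at hQ
  have h2 : A ^ 2 ≤ 2 * ‖f‖ ^ 2 := sq_integral_abs_le f
  nlinarith [le_abs_self (QForm c f)]

theorem exists_mem_orthogonal_chebyshev {n : ℕ}
    (V : Submodule ℝ (Lp ℝ 2 (volume.restrict (Set.Ioo (-1 : ℝ) 1))))
    (hV : Module.finrank ℝ V = n + 1) :
    ∃ f ∈ V, f ≠ 0 ∧
      ∀ k < n, ∫ y in Set.Ioo (-1 : ℝ) 1, Real.cos (k * Real.arccos y) * f y = 0 := by
  have : FiniteDimensional ℝ V := Module.finite_of_finrank_pos (by omega)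
  let L : V →ₗ[ℝ] (Fin n → ℝ) :=
    { toFun := fun f k =>
        ∫ y in Set.Ioo (-1 : ℝ) 1, Real.cos ((k : ℕ) * Real.arccos y) * f.1 y
      map_add' := fun f g => by
        ext k
        rw [Pi.add_apply, ← integral_add (integrable_cos_arccos_mul k f.1)
          (integrable_cos_arccos_mul k g.1)]
        refine integral_congr_ae ?_
        filter_upwards [Lp.coeFn_add f.1 g.1] with y hy
        rw [Submodule.coe_add, hy, Pi.add_apply, mul_add]
      map_smul' := fun r f => by
        ext k
        rw [Pi.smul_apply, RingHom.id_apply, smul_eq_mul, ← integral_const_mul]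
        refine integral_congr_ae ?_
        filter_upwards [Lp.coeFn_smul r f.1] with y hy
        rw [Submodule.coe_smul, hy, Pi.smul_apply, smul_eq_mul]
        ring }
  have hker : LinearMap.ker L ≠ ⊥ :=
    LinearMap.ker_ne_bot_of_finrank_lt (by rw [hV]; simp)
  obtain ⟨f, hf, hf0⟩ := (Submodule.ne_bot_iff _).1 hker
  refine ⟨f.1, f.2, fun h => hf0 (Subtype.ext h), fun k hk => ?_⟩
  exact congrFun (LinearMap.mem_ker.1 hf) ⟨k, hk⟩

theorem lambda_le {c : ℝ} (hc : 0 < c) {n : ℕ} (hn : 1 ≤ n) :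
    lambda n c ≤ 8 * (c / Real.pi * Real.exp (3 / 4 * c)) * (1 / 2) ^ n := by
  have hpos : 0 ≤ c / Real.pi := (div_pos hc Real.pi_pos).le
  refine Real.iSup_le (fun V => ?_) (by positivity)
  by_cases hbdd : BddBelow (Set.range fun f :
      {f : Lp ℝ 2 (volume.restrict (Set.Ioo (-1 : ℝ) 1)) // f ∈ V.1 ∧ f ≠ 0} =>
        QForm c (f.1 : ℝ → ℝ) / ‖f.1‖ ^ 2)
  · obtain ⟨f, hfV, hf0, hf⟩ := exists_mem_orthogonal_chebyshev V.1 V.2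
    refine (ciInf_le hbdd ⟨f, hfV, hf0⟩).trans ?_
    have hfpos : 0 < ‖f‖ := norm_pos_iff.2 hf0
    rw [div_le_iff₀ (by positivity)]
    refine (QForm_le_of_orthogonal (exists_sincKernel_approx hc hn) (by positivity) f hf).trans_eq
      ?_
    ring
  · rw [Real.iInf_of_not_bddBelow hbdd]
    positivity

theorem stmt3 :
    ∃ a δ : ℝ, 0 < a ∧ 1 ≤ δ ∧
      ∀ c : ℝ, 1 ≤ c → ∀ n : ℕ, 1.35 * c < (n:ℝ) →
        lambda n c ≤ δ * Real.exp (-a * n) := by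
  refine ⟨0.1, 400, by norm_num, by norm_num, fun c hc n hn => ?_⟩
  have hn1 : 1 ≤ n := by
    have : (0 : ℝ) < n := by linarith
    exact_mod_cast this
  have hc0 : 0 < c := by linarith
  refine (lambda_le hc0 hn1).trans ?_
  have h1 : c / Real.pi ≤ n :=
    (div_le_self hc0.le (by linarith [Real.pi_gt_three])).trans (by linarith)
  have h2 : (n : ℝ) ≤ 50 * Real.exp (0.02 * n) := by
    linarith [Real.add_one_le_exp (0.02 * (n : ℝ))]
  have h3 : ((1 / 2 : ℝ)) ^ n = Real.exp (-(Real.log 2 * n)) := by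
    rw [Real.exp_neg, Real.exp_mul, Real.exp_log two_pos, Real.rpow_natCast, one_div, inv_pow]
  rw [h3]
  calc 8 * (c / Real.pi * Real.exp (3 / 4 * c)) * Real.exp (-(Real.log 2 * n))
      ≤ 8 * ((50 * Real.exp (0.02 * n)) * Real.exp (3 / 4 * c)) *
          Real.exp (-(Real.log 2 * n)) := by
        gcongr
        exact h1.trans h2
    _ = 400 * Real.exp (0.02 * n + 3 / 4 * c + -(Real.log 2 * n)) := by
        rw [Real.exp_add, Real.exp_add]
        ring
    _ ≤ 400 * Real.exp (-0.1 * n) := by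
        gcongr
        nlinarith [Real.log_two_gt_d9, (Nat.cast_nonneg n : (0 : ℝ) ≤ n)]
end
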